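/- arXiv:0803.3933 — 3 statements merged into one kernel-verified Lean document; each statement's English description precedes it below -/
import Mathlib

section
/- Every hyperfocused 12-arc in PG(2,32) is contained in a hyperconic, i.e., in the union of a conic and its nucleus. -/
open scoped LinearAlgebra.Projectivization

/-- The projective plane over a field `F`. -/
abbrev PG2 (F : Type*) [Field F] := Projectivization F (Fin 3 → F)

variable {F : Type*} [Field F]

/-- A line of `PG2 F`: the zero set of a nonzero linear form. -/
def IsLine (l : Set (PG2 F)) : Prop :=
  ∃ f : (Fin 3 → F) →ₗ[F] F, f ≠ 0 ∧ l = {P : PG2 F | f P.rep = 0}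

/-- Three points of `PG2 F` are collinear if some line contains them all. -/
def Collinear3 (A B C : PG2 F) : Prop :=
  ∃ l : Set (PG2 F), IsLine l ∧ A ∈ l ∧ B ∈ l ∧ C ∈ l

/-- An arc: a set of points no three of which are collinear, i.e. every line
meets it in at most two points. -/
def IsArc (K : Set (PG2 F)) : Prop :=
  ∀ l : Set (PG2 F), IsLine l → (K ∩ l).ncard ≤ 2

/-- A secant (chord) of `K`: a line containing at least two points of `K`. -/
def IsSecant (K l : Set (PG2 F)) : Prop :=
  IsLine l ∧ 2 ≤ (K ∩ l).ncard

/-- A blocking set of the secants of `K`: a set of points disjoint from `K`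
meeting every secant of `K`. -/
def IsBlockingSet (K B : Set (PG2 F)) : Prop :=
  B ∩ K = ∅ ∧ ∀ l : Set (PG2 F), IsSecant K l → (B ∩ l).Nonempty

/-- The focus set of `K` on `l`: the points of `l` lying on some secant of `K`. -/
def FocusSet (K l : Set (PG2 F)) : Set (PG2 F) :=
  {P : PG2 F | P ∈ l ∧ ∃ m : Set (PG2 F), IsSecant K m ∧ P ∈ m}

/-- `K` is hyperfocused on the exterior line `l` if the secants of `K` meet `l`
in exactly `|K| - 1` points. -/
def Hyperfocused (K l : Set (PG2 F)) : Prop :=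
  IsLine l ∧ K ∩ l = ∅ ∧ (FocusSet K l).ncard = K.ncard - 1

/-- `K` is sharply focused on the exterior line `l` if the secants of `K` meet `l`
in exactly `|K|` points. -/
def SharplyFocused (K l : Set (PG2 F)) : Prop :=
  IsLine l ∧ K ∩ l = ∅ ∧ (FocusSet K l).ncard = K.ncard

/-- A conic: the zero set of an irreducible homogeneous quadratic form. -/
def IsConic (C : Set (PG2 F)) : Prop :=
  ∃ Q : MvPolynomial (Fin 3) F, Q.IsHomogeneous 2 ∧ Irreducible Q ∧
    C = {P : PG2 F | MvPolynomial.eval P.rep Q = 0}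

/-- A tangent line to a point set `C`: a line meeting `C` in exactly one point. -/
def IsTangentLine (C l : Set (PG2 F)) : Prop :=
  IsLine l ∧ (C ∩ l).ncard = 1

/-- A projectivity of `PG2 F`: a map induced by a linear automorphism. -/
def IsProjectivity (φ : PG2 F → PG2 F) : Prop :=
  ∃ g : (Fin 3 → F) ≃ₗ[F] (Fin 3 → F),
    ∀ P : PG2 F, φ P = Projectivization.map g.toLinearMap g.injective P

lemma mk3_ne_zero {a b c : F} (h : a ≠ 0 ∨ b ≠ 0 ∨ c ≠ 0) :
    (![a, b, c] : Fin 3 → F) ≠ 0 := by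
  intro hv
  rcases h with h | h | h
  · exact h (by simpa using congrFun hv 0)
  · exact h (by simpa using congrFun hv 1)
  · exact h (by simpa using congrFun hv 2)

/-- The point of `PG2 F` with homogeneous coordinates `(a, b, c)`. -/
def pt (a b c : F) (h : (![a, b, c] : Fin 3 → F) ≠ 0) : PG2 F :=
  Projectivization.mk F ![a, b, c] h

/-- The linear automorphism `(X₁, X₂, X₃) ↦ (X₁ + a₁·X₃, X₂ + a₂·X₃, X₃)`. -/
def tEquiv (A : F × F) : (Fin 3 → F) ≃ₗ[F] (Fin 3 → F) where
  toFun v := ![v 0 + A.1 * v 2, v 1 + A.2 * v 2, v 2]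
  invFun v := ![v 0 - A.1 * v 2, v 1 - A.2 * v 2, v 2]
  left_inv v := by funext i; fin_cases i <;> simp
  right_inv v := by funext i; fin_cases i <;> simp
  map_add' u v := by funext i; fin_cases i <;> simp <;> ring
  map_smul' c v := by funext i; fin_cases i <;> simp <;> ring

/-- The projectivity `φ_A` of `PG2 F` induced by `tEquiv A`. -/
def tφ (A : F × F) : PG2 F → PG2 F :=
  Projectivization.map (tEquiv A).toLinearMap (tEquiv A).injective

/-- The orbit `K_G(P)` of a point `P` under the translation group `T_G`. -/
def tOrbit (G : AddSubgroup (F × F)) (P : PG2 F) : Set (PG2 F) :=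
  {Q : PG2 F | ∃ A ∈ G, Q = tφ A P}

/-- A translation arc: an arc which is an orbit `K_G(P)`. -/
def IsTranslationArc (K : Set (PG2 F)) : Prop :=
  IsArc K ∧ ∃ (G : AddSubgroup (F × F)) (P : PG2 F), K = tOrbit G P

/-- The `k`-th elementary symmetric function of a finite family. -/
def esymmFam {A ι : Type*} [CommRing A] [Fintype ι] (a : ι → A) (k : ℕ) : A :=
  ∑ s ∈ Finset.univ.powersetCard k, ∏ i ∈ s, a i

section SymmetricFunctions

open Finset

variable {A B ι : Type*} [CommRing A] [CommRing B] [Fintype ι]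

lemma esymmFam_zero (a : ι → A) : esymmFam a 0 = 1 := by simp [esymmFam]

lemma esymmFam_card (a : ι → A) : esymmFam a (Fintype.card ι) = ∏ i, a i := by
  rw [esymmFam, ← Finset.card_univ, powersetCard_self, sum_singleton]

lemma map_esymmFam (φ : A →+* B) (a : ι → A) (k : ℕ) :
    φ (esymmFam a k) = esymmFam (fun i => φ (a i)) k := by
  simp [esymmFam, map_sum, map_prod]

lemma esymmFam_smul (c : A) (a : ι → A) (k : ℕ) :
    esymmFam (fun i => c * a i) k = c ^ k * esymmFam a k := by
  unfold esymmFam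
  rw [mul_sum]
  refine sum_congr rfl fun s hs => ?_
  rw [prod_mul_distrib, prod_const, (mem_powersetCard.1 hs).2]

open Polynomial in
lemma natDegree_esymmFam_le (a : ι → A[X]) (h : ∀ i, (a i).natDegree ≤ 1) (k : ℕ) :
    (esymmFam a k).natDegree ≤ k := by
  refine natDegree_sum_le_of_forall_le _ _ fun s hs => ?_
  refine (natDegree_prod_le _ _).trans ?_
  refine (sum_le_card_nsmul _ _ 1 fun i _ => h i).trans ?_
  simp [(mem_powersetCard.1 hs).2]

lemma prod_add_eq_sum_esymmFam (a : ι → A) (t : A) :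
    ∏ i, (a i + t) = ∑ k ∈ range (Fintype.card ι + 1),
      esymmFam a k * t ^ (Fintype.card ι - k) := by
  classical
  rw [prod_add, sum_powerset, Finset.card_univ]
  refine sum_congr rfl fun k _ => ?_
  rw [esymmFam, sum_mul]
  refine sum_congr rfl fun s hs => ?_
  rw [prod_const, card_sdiff_of_subset (subset_univ s), (mem_powersetCard.1 hs).2,
    Finset.card_univ]

lemma newton_esymmFam (a : ι → A) (k : ℕ) :
    (k : A) * esymmFam a k = (-1) ^ (k + 1) *
      ∑ b ∈ antidiagonal k with b.1 < k, (-1) ^ b.1 * esymmFam a b.1 * ∑ i, a i ^ b.2 := by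
  have h := congrArg (MvPolynomial.aeval a) (MvPolynomial.mul_esymm_eq_sum ι A k)
  have he : ∀ j, MvPolynomial.eval a (MvPolynomial.esymm ι A j) = esymmFam a j := by
    intro j
    simp [MvPolynomial.esymm, esymmFam, map_sum, map_prod]
  simpa [he, MvPolynomial.psum, map_sum] using h

lemma esymmFam_eq_zero_of_odd [CharP A 2] (a : ι → A) {k : ℕ} (hk : Odd k)
    (hp : ∀ j, 0 < j → j ≤ k → ∑ i, a i ^ j = 0) : esymmFam a k = 0 := by
  have h := newton_esymmFam a k
  rw [sum_eq_zero, mul_zero, CharTwo.natCast_eq_ite, if_neg (Nat.not_even_iff_odd.2 hk),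
    one_mul] at h
  · exact h
  · intro b hb
    rw [mem_filter, Finset.HasAntidiagonal.mem_antidiagonal] at hb
    rw [hp b.2 (by omega) (by omega), mul_zero]

lemma pow_eleven_relation [CharP A 2] (a : Fin 11 → A)
    (hp : ∀ j, 0 < j → j ≤ 10 → ∑ i, a i ^ j = 0) (i : Fin 11) :
    a i ^ 11 + esymmFam a 2 * a i ^ 9 + esymmFam a 4 * a i ^ 7 + esymmFam a 6 * a i ^ 5 +
      esymmFam a 8 * a i ^ 3 + esymmFam a 10 * a i + esymmFam a 11 = 0 := by
  have hodd : ∀ k, Odd k → k ≤ 10 → esymmFam a k = 0 := fun k hk hk' =>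
    esymmFam_eq_zero_of_odd a hk fun j h0 hj => hp j h0 (hj.trans hk')
  have h := prod_add_eq_sum_esymmFam a (a i)
  rw [prod_eq_zero (mem_univ i) (CharTwo.add_self_eq_zero _)] at h
  simp only [Fintype.card_fin, sum_range_succ, range_zero, sum_empty, esymmFam_zero,
    hodd 1 (by decide) (by decide), hodd 3 (by decide) (by decide),
    hodd 5 (by decide) (by decide), hodd 7 (by decide) (by decide),
    hodd 9 (by decide) (by decide)] at h
  norm_num at h
  linear_combination -h

lemma sum_pow_add_eleven [CharP A 2] (a : Fin 11 → A)
    (hp : ∀ j, 0 < j → j ≤ 10 → ∑ i, a i ^ j = 0) (n : ℕ) :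
    ∑ i, a i ^ (n + 11) = esymmFam a 2 * ∑ i, a i ^ (n + 9) + esymmFam a 4 * ∑ i, a i ^ (n + 7) +
      esymmFam a 6 * ∑ i, a i ^ (n + 5) + esymmFam a 8 * ∑ i, a i ^ (n + 3) +
      esymmFam a 10 * ∑ i, a i ^ (n + 1) + esymmFam a 11 * ∑ i, a i ^ n := by
  simp only [mul_sum, ← sum_add_distrib]
  refine sum_congr rfl fun i _ => ?_
  have h2 : (2 : A) = 0 := CharTwo.two_eq_zero
  have h := pow_eleven_relation a hp i
  linear_combination a i ^ n * h - a i ^ n * (esymmFam a 2 * a i ^ 9 + esymmFam a 4 * a i ^ 7 +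
    esymmFam a 6 * a i ^ 5 + esymmFam a 8 * a i ^ 3 + esymmFam a 10 * a i + esymmFam a 11) * h2

lemma sum_pow_two_mul [CharP A 2] (a : ι → A) (n : ℕ) :
    ∑ i, a i ^ (2 * n) = (∑ i, a i ^ n) ^ 2 := by
  rw [sum_pow_char 2]
  exact sum_congr rfl fun i _ => by ring

end SymmetricFunctions

/-- The relations among the elementary symmetric functions of eleven linear forms, in
characteristic two, that characterise the factors of a Dickson polynomial up to translation. -/
structure DicksonRelations {A : Type*} [CommRing A] (a : Fin 11 → A) : Prop where
  sum_pow : ∀ k, 0 < k → k ≤ 10 → ∑ i, a i ^ k = 0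
  six : esymmFam a 6 = esymmFam a 2 ^ 3
  eight : esymmFam a 8 = esymmFam a 2 ^ 4 + esymmFam a 2 ^ 2 * esymmFam a 4 + esymmFam a 4 ^ 2
  ten : esymmFam a 10 = esymmFam a 2 * esymmFam a 4 ^ 2 + esymmFam a 2 ^ 5

namespace DicksonRelations

variable {A B : Type*} [CommRing A] [CommRing B] {a : Fin 11 → A}

lemma map (h : DicksonRelations a) (φ : A →+* B) : DicksonRelations fun i => φ (a i) where
  sum_pow k h0 hk := by simpa using congrArg φ (h.sum_pow k h0 hk)
  six := by simpa [map_esymmFam] using congrArg φ h.six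
  eight := by simpa [map_esymmFam] using congrArg φ h.eight
  ten := by simpa [map_esymmFam] using congrArg φ h.ten

lemma of_map {φ : A →+* B} (hφ : Function.Injective φ)
    (h : DicksonRelations fun i => φ (a i)) : DicksonRelations a where
  sum_pow k h0 hk := hφ (by simpa using h.sum_pow k h0 hk)
  six := hφ (by simpa [map_esymmFam] using h.six)
  eight := hφ (by simpa [map_esymmFam] using h.eight)
  ten := hφ (by simpa [map_esymmFam] using h.ten)

lemma const_mul (h : DicksonRelations a) (c : A) : DicksonRelations fun i => c * a i where
  sum_pow k h0 hk := by simp [mul_pow, ← Finset.mul_sum, h.sum_pow k h0 hk]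
  six := by simp only [esymmFam_smul, h.six]; ring
  eight := by simp only [esymmFam_smul, h.eight]; ring
  ten := by simp only [esymmFam_smul, h.ten]; ring

lemma sum_pow_thirteen [CharP A 2] (h : DicksonRelations a) :
    ∑ i, a i ^ 13 = esymmFam a 2 * ∏ i, a i := by
  have h11 := sum_pow_add_eleven a h.sum_pow 0
  have h13 := sum_pow_add_eleven a h.sum_pow 2
  have hc : esymmFam a 11 = ∏ i, a i := by simpa using esymmFam_card a
  simp only [h.sum_pow 1 (by decide) (by decide), h.sum_pow 3 (by decide) (by decide),
    h.sum_pow 5 (by decide) (by decide), h.sum_pow 7 (by decide) (by decide),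
    h.sum_pow 9 (by decide) (by decide), h.sum_pow 2 (by decide) (by decide),
    Nat.reduceAdd, hc, pow_zero, Finset.sum_const, Finset.card_univ, Fintype.card_fin,
    nsmul_eq_mul, mul_zero, mul_one, add_zero, zero_add] at h11 h13
  have h2 : (2 : A) = 0 := CharTwo.two_eq_zero
  rw [h13, h11]
  push_cast
  linear_combination 5 * esymmFam a 2 * (∏ i, a i) * h2

end DicksonRelations

section FieldOfOrder32

open Finset Polynomial

variable {F : Type*} [Field F] [Fintype F]

lemma charP_two_of_card_eq (hF : Fintype.card F = 32) : CharP F 2 := by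
  obtain ⟨p, hp⟩ := CharP.exists F
  obtain ⟨n, hpp, hn⟩ := FiniteField.card F p
  rw [hF] at hn
  have : p ∣ 2 ^ 5 := (by norm_num : (2 : ℕ) ^ 5 = 32) ▸ hn ▸ dvd_pow_self p n.ne_zero
  rwa [(Nat.prime_dvd_prime_iff_eq hpp Nat.prime_two).1 (hpp.dvd_of_dvd_pow this)] at hp

/-- Pointwise form of the relations over the field with 32 elements. -/
lemma pointwise_relations [CharP F 2] (hF : Fintype.card F = 32) (a : Fin 11 → F)
    (hp : ∀ k, 0 < k → k ≤ 10 → ∑ i, a i ^ k = 0) (h0 : ∀ i, a i ≠ 0) :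
    esymmFam a 2 ≠ 0 ∧ DicksonRelations a := by
  have hpow : ∀ t : F, t ^ 32 = t := fun t => hF ▸ FiniteField.pow_card t
  have hred : ∀ n, ∑ i, a i ^ (n + 32) = ∑ i, a i ^ (n + 1) := fun n =>
    sum_congr rfl fun i _ => by rw [pow_add, hpow, pow_succ]
  have h2 : (2 : F) = 0 := CharTwo.two_eq_zero
  set σ := esymmFam a 11 with hσ
  have hσ0 : σ ≠ 0 := by
    rw [hσ, show esymmFam a 11 = ∏ i, a i by simpa using esymmFam_card a]
    exact prod_ne_zero_iff.2 fun i _ => h0 i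
  have hrec := sum_pow_add_eleven a hp
  have hsq := sum_pow_two_mul a
  have e1 := hp 1 (by decide) (by decide)
  have e2 := hp 2 (by decide) (by decide)
  have e3 := hp 3 (by decide) (by decide)
  have e4 := hp 4 (by decide) (by decide)
  have e5 := hp 5 (by decide) (by decide)
  have e6 := hp 6 (by decide) (by decide)
  have e7 := hp 7 (by decide) (by decide)
  have e8 := hp 8 (by decide) (by decide)
  have e9 := hp 9 (by decide) (by decide)
  have e10 := hp 10 (by decide) (by decide)
  have h11 : ∑ i, a i ^ 11 = σ := by
    have h := hrec 0
    simp only [Nat.reduceAdd, pow_zero, sum_const, Finset.card_univ, Fintype.card_fin,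
      nsmul_eq_mul, ← hσ, e1, e3, e5, e7, e9] at h
    push_cast at h
    linear_combination h + 5 * σ * h2
  have h13 := hrec 2
  have h15 := hrec 4
  have h17 := hrec 6
  have h19 := hrec 8
  have h21 := hrec 10
  simp only [Nat.reduceAdd, ← hσ, e2, e3, e4, e5, e6, e7, e8, e9, e10, h11, mul_zero,
    add_zero] at h13 h15 h17 h19 h21
  have q13 : ∑ i, a i ^ 13 = σ ^ 4 := by
    have hu := hsq 22
    have hv := hsq 11
    have hw := hred 12
    norm_num at hu hv hw
    rw [← hw, hu, hv, h11]; ring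
  have q17 : ∑ i, a i ^ 17 = 0 := by
    have hu := hsq 17
    have hw := hred 2
    norm_num at hu hw
    exact pow_eq_zero_iff two_ne_zero |>.1 (by rw [← hu, hw, e3])
  have q19 : ∑ i, a i ^ 19 = 0 := by
    have hu := hsq 19
    have hw := hred 6
    norm_num at hu hw
    exact pow_eq_zero_iff two_ne_zero |>.1 (by rw [← hu, hw, e7])
  have q21 : (∑ i, a i ^ 21) ^ 2 = σ := by
    have hu := hsq 21
    have hw := hred 10
    norm_num at hu hw
    rw [← hu, hw, h11]
  set s2 := esymmFam a 2
  set s4 := esymmFam a 4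
  have hs2 : s2 = σ ^ 3 := mul_right_cancel₀ hσ0 (by rw [← h13, q13]; ring)
  have hs6 : esymmFam a 6 = s2 ^ 3 := by
    refine mul_right_cancel₀ hσ0 ?_
    rw [q17, h15, h13] at h17
    linear_combination -h17 - (s2 ^ 3 + s2 * s4) * σ * h2
  have hs8 : esymmFam a 8 = s2 ^ 4 + s2 ^ 2 * s4 + s4 ^ 2 := by
    refine mul_right_cancel₀ hσ0 ?_
    rw [q19, q17, h15, h13, hs6] at h19
    linear_combination -h19 - (s2 ^ 4 + s2 ^ 2 * s4 + s4 ^ 2) * σ * h2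
  have hs10 : esymmFam a 10 = s2 * s4 ^ 2 + s2 ^ 5 := by
    have hσ31 : σ ^ 31 = 1 := mul_right_cancel₀ hσ0 (by rw [← pow_succ, hpow, one_mul])
    rw [q19, q17, h15, h13, hs6, hs8] at h21
    have hh : ((esymmFam a 10 + s2 * s4 ^ 2) * σ) ^ 2 = (s2 ^ 5 * σ) ^ 2 := by
      have : (esymmFam a 10 + s2 * s4 ^ 2) * σ = ∑ i, a i ^ 21 := by
        rw [h21]
        linear_combination -(s2 ^ 5 + s2 ^ 3 * s4) * σ * h2
      rw [this, q21, hs2]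
      linear_combination -σ * hσ31
    have := mul_right_cancel₀ hσ0 (CharTwo.sq_inj.1 hh)
    linear_combination this - s2 * s4 ^ 2 * h2
  exact ⟨hs2 ▸ pow_ne_zero 3 hσ0, hp, hs6, hs8, hs10⟩

lemma dicksonRelations_of_slopes [CharP F 2] (hF : Fintype.card F = 32) (x y : Fin 11 → F)
    (D : Finset F) (hD : D.card = 11)
    (hp : ∀ d ∈ D, ∀ k, 0 < k → ∑ i, (x i * d + y i) ^ k = 0)
    (hn : ∀ d ∉ D, ∀ i, x i * d + y i ≠ 0) :
    DicksonRelations (fun i => C (x i) * X + C (y i)) ∧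
      esymmFam (fun i => C (x i) * X + C (y i)) 2 ≠ 0 := by
  classical
  set ℓ : Fin 11 → F[X] := fun i => C (x i) * X + C (y i) with hℓ
  have hdeg : ∀ i, (ℓ i).natDegree ≤ 1 := fun i => natDegree_linear_le
  have heval : ∀ d i, (ℓ i).eval d = x i * d + y i := fun d i => by simp [hℓ]
  have hes : ∀ d k, (esymmFam ℓ k).eval d = esymmFam (fun i => x i * d + y i) k := fun d k => by
    simpa [heval] using map_esymmFam (evalRingHom d) ℓ k
  have hes_deg := natDegree_esymmFam_le ℓ hdeg
  have hsum : ∀ k, 0 < k → k ≤ 10 → ∑ i, ℓ i ^ k = 0 := by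
    intro k h0 hk
    refine eq_zero_of_natDegree_lt_card_of_eval_eq_zero' _ D (fun d hd => ?_) ?_
    · simpa [eval_finsetSum, heval] using hp d hd k h0
    · refine lt_of_le_of_lt (natDegree_sum_le_of_forall_le (n := k) _ _ fun i _ => ?_) (by omega)
      exact (natDegree_pow_le_of_le k (hdeg i)).trans (by simp)
  have hrel : ∀ d ∉ D, esymmFam (fun i => x i * d + y i) 2 ≠ 0 ∧
      DicksonRelations fun i => x i * d + y i := fun d hd =>
    pointwise_relations hF _ (fun k h0 hk => by
      simpa [eval_finsetSum, heval] using congrArg (eval d) (hsum k h0 hk)) (hn d hd)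
  have hcompl : (univ \ D).card = 21 := by
    rw [card_sdiff_of_subset (subset_univ D), Finset.card_univ, hF, hD]
  have hzero : ∀ P : F[X], P.natDegree ≤ 10 → (∀ d ∉ D, P.eval d = 0) → P = 0 := by
    intro P hP h
    refine eq_zero_of_natDegree_lt_card_of_eval_eq_zero' P (univ \ D) (fun d hd => ?_) (by omega)
    exact h d (mem_sdiff.1 hd).2
  have hpow : ∀ k n, k * n ≤ 10 → (esymmFam ℓ k ^ n).natDegree ≤ 10 := fun k n h =>
    (natDegree_pow_le_of_le n (hes_deg k)).trans (by rwa [mul_comm])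
  have hmul : ∀ k m, 2 * k + 4 * m ≤ 10 →
      (esymmFam ℓ 2 ^ k * esymmFam ℓ 4 ^ m).natDegree ≤ 10 := fun k m h =>
    (natDegree_mul_le_of_le (natDegree_pow_le_of_le k (hes_deg 2))
      (natDegree_pow_le_of_le m (hes_deg 4))).trans (by omega)
  have hsub : ∀ p q : F[X], p.natDegree ≤ 10 → q.natDegree ≤ 10 →
      (∀ d ∉ D, p.eval d = q.eval d) → p = q := fun p q hp hq h =>
    sub_eq_zero.1 (hzero _ ((natDegree_sub_le p q).trans (max_le hp hq)) fun d hd => by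
      rw [eval_sub, h d hd, sub_self])
  have hadd : ∀ p q : F[X], p.natDegree ≤ 10 → q.natDegree ≤ 10 → (p + q).natDegree ≤ 10 :=
    fun _ _ => natDegree_add_le_of_degree_le
  refine ⟨⟨hsum, ?_, ?_, ?_⟩, fun h => ?_⟩
  · refine hsub _ _ ((hes_deg 6).trans (by omega)) (hpow 2 3 (by omega)) fun d hd => ?_
    rw [eval_pow, hes, hes, (hrel d hd).2.six]
  · refine hsub _ _ ((hes_deg 8).trans (by omega)) (hadd _ _ (hadd _ _ (hpow 2 4 (by omega))
      (by simpa only [pow_one] using hmul 2 1 (by omega))) (hpow 4 2 (by omega))) fun d hd => ?_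
    rw [eval_add, eval_add, eval_mul, eval_pow, eval_pow, eval_pow, hes, hes, hes,
      (hrel d hd).2.eight]
  · refine hsub _ _ (hes_deg 10) (hadd _ _
      (by simpa only [pow_one] using hmul 1 2 (by omega)) (hpow 2 5 (by omega))) fun d hd => ?_
    rw [eval_add, eval_mul, eval_pow, eval_pow, hes, hes, hes, (hrel d hd).2.ten]
  · obtain ⟨d, hd⟩ : (univ \ D).Nonempty := card_pos.1 (by omega)
    refine (hrel d (mem_sdiff.1 hd).2).1 ?_
    rw [← hes, h, eval_zero]

end FieldOfOrder32

section LocalExpansion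

open Finset Polynomial

variable {E : Type*} [Field E]

lemma exists_expansion_four (p : E[X]) : ∃ r : E[X],
    p = C (p.coeff 0) + C (p.coeff 1) * X + C (p.coeff 2) * X ^ 2 + C (p.coeff 3) * X ^ 3 +
      X ^ 4 * r := by
  obtain ⟨r, hr⟩ : X ^ 4 ∣ p - (C (p.coeff 0) + C (p.coeff 1) * X + C (p.coeff 2) * X ^ 2 +
      C (p.coeff 3) * X ^ 3) := by
    rw [X_pow_dvd_iff]
    intro d hd
    interval_cases d <;> simp [coeff_X, coeff_X_pow, coeff_C]
  exact ⟨r, by rw [← hr]; ring⟩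

lemma coeffs_eq_zero_of_expansion_four {a b c d : E} {r : E[X]}
    (h : C a + C b * X + C c * X ^ 2 + C d * X ^ 3 + X ^ 4 * r = 0) :
    a = 0 ∧ b = 0 ∧ c = 0 ∧ d = 0 := by
  have h' := fun n => congrArg (fun q => coeff q n) h
  have h0 := h' 0
  have h1 := h' 1
  have h2 := h' 2
  have h3 := h' 3
  simp [coeff_X, coeff_X_pow, coeff_C, coeff_X_pow_mul'] at h0 h1 h2 h3
  exact ⟨h0, h1, h2, h3⟩

lemma prod_coeff_one (z w : Fin 11 → E) (i : Fin 11) (hi : z i = 0) :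
    (∏ j, (C (z j) + C (w j) * X)).coeff 1 = w i * ∏ j ∈ univ.erase i, z j := by
  rw [← mul_prod_erase univ _ (mem_univ i), hi, map_zero, zero_add, mul_assoc, coeff_C_mul,
    show (1 : ℕ) = 0 + 1 from rfl, coeff_X_mul, ← constantCoeff_apply, map_prod]
  simp

/-- Two coefficients of the product of the linear forms cannot vanish together, unless two of
the forms are proportional. -/
lemma not_coeffs_eq_zero (z w : Fin 11 → E) (hw : ∀ i, z i = 0 → w i ≠ 0)
    (hz : ∀ i j, z i = 0 → z j = 0 → i = j)
    (h0 : (∏ j, (C (z j) + C (w j) * X)).coeff 0 = 0)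
    (h1 : (∏ j, (C (z j) + C (w j) * X)).coeff 1 = 0) : False := by
  rw [← constantCoeff_apply, map_prod, prod_eq_zero_iff] at h0
  obtain ⟨i, -, hi⟩ := h0
  have hi : z i = 0 := by simpa using hi
  rw [prod_coeff_one z w i hi] at h1
  rcases mul_eq_zero.1 h1 with h | h
  · exact hw i hi h
  · obtain ⟨j, hj, hj0⟩ := prod_eq_zero_iff.1 h
    exact (mem_erase.1 hj).1 (hz j i hj0 hi)

lemma coeff_eq_zero_of_many_zeros {z : Fin 11 → E} (hz : Function.Injective z) {A B G : E}
    (h : ∀ i, A * z i ^ 8 + B * z i ^ 4 + G * z i = 0) : B = 0 := by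
  have h0 : C A * X ^ 8 + C B * X ^ 4 + C G * X = 0 := by
    refine eq_zero_of_natDegree_lt_card_of_eval_eq_zero _ hz (fun i => by simpa using h i) ?_
    refine lt_of_le_of_lt (b := 8) (by compute_degree) (by simp)
  simpa [coeff_X] using congrArg (fun p => coeff p 4) h0

variable [CharP E 2]

/-- In characteristic two, a sum of thirteenth powers of linear forms has no quadratic and no
cubic term. -/
lemma exists_sum_pow_thirteen (z w : Fin 11 → E) : ∃ (b c : E) (r : E[X]),
    ∑ i, (C (z i) + C (w i) * X) ^ 13 = C b + C c * X + X ^ 4 * r := by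
  refine ⟨∑ i, z i ^ 13, ∑ i, z i ^ 12 * w i, ∑ i, ((C (z i) + C (w i) * X) *
    (C (w i) ^ 4 * C (z i) ^ 8 + C (w i) ^ 8 * C (z i) ^ 4 * X ^ 4 +
      C (w i) ^ 12 * X ^ 8)), ?_⟩
  simp only [map_sum, mul_sum, sum_mul, ← sum_add_distrib]
  refine sum_congr rfl fun i _ => ?_
  have h4 : (C (z i) + C (w i) * X) ^ 4 = C (z i) ^ 4 + C (w i) ^ 4 * X ^ 4 := by
    have := add_pow_char_pow (p := 2) (n := 2) (C (z i)) (C (w i) * X)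
    norm_num at this
    rw [this]; ring
  have h8 : (C (z i) + C (w i) * X) ^ 8 = C (z i) ^ 8 + C (w i) ^ 8 * X ^ 8 := by
    have := add_pow_char_pow (p := 2) (n := 3) (C (z i)) (C (w i) * X)
    norm_num at this
    rw [this]; ring
  calc (C (z i) + C (w i) * X) ^ 13
      = (C (z i) + C (w i) * X) * (C (z i) + C (w i) * X) ^ 4 *
          (C (z i) + C (w i) * X) ^ 8 := by ring
    _ = _ := by
      rw [h4, h8]
      simp only [map_mul, map_pow]
      ring

/-- The second symmetric function has no double zero. -/
lemma esymm_two_ne_const_mul_sq (z w : Fin 11 → E)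
    (hD : DicksonRelations fun i => C (z i) + C (w i) * X) {γ : E} (hγ : γ ≠ 0)
    (hw : ∀ i, z i = 0 → w i ≠ 0) (hz : ∀ i j, z i = 0 → z j = 0 → i = j) :
    esymmFam (fun i => C (z i) + C (w i) * X) 2 ≠ C γ * X ^ 2 := by
  intro hs
  obtain ⟨b, c, r, hr⟩ := exists_sum_pow_thirteen z w
  have h := hD.sum_pow_thirteen
  obtain ⟨q, hq⟩ := exists_expansion_four (∏ i, (C (z i) + C (w i) * X))
  set P := ∏ i, (C (z i) + C (w i) * X)
  rw [hr, hs, hq] at h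
  obtain ⟨-, -, h0, h1⟩ := coeffs_eq_zero_of_expansion_four (a := b) (b := c)
    (c := -(γ * P.coeff 0)) (d := -(γ * P.coeff 1))
    (r := r - C γ * (C (P.coeff 2) + C (P.coeff 3) * X + X ^ 2 * q)) (by
      simp only [map_neg, map_mul]
      linear_combination h)
  exact not_coeffs_eq_zero z w hw hz (by simpa [hγ] using h0) (by simpa [hγ] using h1)

/-- The coefficients of the relation satisfied by the eleven linear forms when the second
symmetric function is the variable. -/
lemma exists_coeff_relations (z w : Fin 11 → E)
    (hD : DicksonRelations fun i => C (z i) + C (w i) * X)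
    (h2 : esymmFam (fun i => C (z i) + C (w i) * X) 2 = X)
    (hw : ∀ i, z i = 0 → w i ≠ 0) (hz : ∀ i j, z i = 0 → z j = 0 → i = j) :
    ∃ c c₃ t₀ t₁ t₂ t₃ : E, c ≠ 0 ∧ (∀ i, z i ≠ 0) ∧ ∀ i,
      z i ^ 12 + t₀ * z i ^ 8 + t₀ ^ 2 * z i ^ 4 + c * z i = 0 ∧
      z i ^ 10 + t₁ * z i ^ 8 + t₀ ^ 2 * z i ^ 2 + c * w i = 0 ∧
      t₂ * z i ^ 8 + (t₀ + t₁ ^ 2) * z i ^ 4 = 0 ∧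
      z i ^ 8 * w i ^ 2 + t₃ * z i ^ 8 + z i ^ 6 + t₁ * z i ^ 4 + t₁ ^ 2 * z i ^ 2 +
        t₀ ^ 2 * w i ^ 2 + c₃ * z i = 0 := by
  obtain ⟨b, b', r, hr⟩ := exists_sum_pow_thirteen z w
  have h13 := hD.sum_pow_thirteen
  have hσ : esymmFam (fun i => C (z i) + C (w i) * X) 11 = ∏ i, (C (z i) + C (w i) * X) := by
    simpa using esymmFam_card fun i => C (z i) + C (w i) * X
  obtain ⟨q₃, hq₃⟩ := exists_expansion_four (∏ i, (C (z i) + C (w i) * X))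
  obtain ⟨q, hq⟩ := exists_expansion_four (esymmFam (fun i => C (z i) + C (w i) * X) 4)
  have hnot := not_coeffs_eq_zero z w hw hz
  have hc0 : (∏ i, (C (z i) + C (w i) * X)).coeff 0 = ∏ i, z i := by
    rw [← constantCoeff_apply, map_prod]
    simp
  have hroot := pow_eleven_relation _ hD.sum_pow
  simp only [hD.six, hD.eight, hD.ten, h2, hσ] at hroot h13
  set P := ∏ i, (C (z i) + C (w i) * X)
  set s := esymmFam (fun i => C (z i) + C (w i) * X) 4
  rw [hr] at h13
  obtain ⟨-, -, h1, h2⟩ := coeffs_eq_zero_of_expansion_four (a := b) (b := b' - P.coeff 0)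
    (c := -P.coeff 1) (d := -P.coeff 2) (r := r - C (P.coeff 3) - X * q₃) (by
      rw [hq₃] at h13
      simp only [map_neg, map_sub]
      linear_combination h13)
  rw [neg_eq_zero] at h1 h2
  have hc : P.coeff 0 ≠ 0 := fun h => hnot h h1
  rw [h1, h2] at hq₃
  generalize P.coeff 0 = c at *
  generalize P.coeff 3 = c₃ at *
  generalize s.coeff 0 = t₀ at *
  generalize s.coeff 1 = t₁ at *
  generalize s.coeff 2 = t₂ at *
  generalize s.coeff 3 = t₃ at *
  have hS : s ^ 2 = C t₀ ^ 2 + C t₁ ^ 2 * X ^ 2 +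
      X ^ 4 * (C t₂ ^ 2 + C t₃ ^ 2 * X ^ 2 + X ^ 4 * q ^ 2) := by
    rw [hq, CharTwo.add_sq, CharTwo.add_sq, CharTwo.add_sq, CharTwo.add_sq]
    ring
  refine ⟨c, c₃, t₀, t₁, t₂, t₃, hc, fun i => ?_, fun i => ?_⟩
  · rw [hc0] at hc
    exact prod_ne_zero_iff.1 hc i (mem_univ i)
  have hi := hroot i
  set ℓ := C (z i) + C (w i) * X with hℓ
  have l2 : ℓ ^ 2 = C (z i) ^ 2 + C (w i) ^ 2 * X ^ 2 := by
    rw [hℓ, CharTwo.add_sq]; ring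
  have l4 : ℓ ^ 4 = C (z i) ^ 4 + X ^ 4 * C (w i) ^ 4 := by
    rw [show ℓ ^ 4 = (ℓ ^ 2) ^ 2 by ring, l2, CharTwo.add_sq]; ring
  have l8 : ℓ ^ 8 = C (z i) ^ 8 + X ^ 4 * (C (w i) ^ 8 * X ^ 4) := by
    rw [show ℓ ^ 8 = (ℓ ^ 4) ^ 2 by ring, l4, CharTwo.add_sq]; ring
  have key : ℓ ^ 8 * ℓ ^ 4 + X * (ℓ ^ 8 * ℓ ^ 2) + s * ℓ ^ 8 + X ^ 3 * (ℓ ^ 4 * ℓ ^ 2) +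
      (X ^ 4 + X ^ 2 * s + s ^ 2) * ℓ ^ 4 + (X * s ^ 2 + X ^ 5) * ℓ ^ 2 + P * ℓ = 0 := by
    linear_combination ℓ * hi
  rw [l8, l4, l2, hS, hq, hq₃, hℓ] at key
  obtain ⟨e0, e1, e2, e3⟩ := coeffs_eq_zero_of_expansion_four
    (a := z i ^ 12 + t₀ * z i ^ 8 + t₀ ^ 2 * z i ^ 4 + c * z i)
    (b := z i ^ 10 + t₁ * z i ^ 8 + t₀ ^ 2 * z i ^ 2 + c * w i)
    (c := t₂ * z i ^ 8 + (t₀ + t₁ ^ 2) * z i ^ 4)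
    (d := z i ^ 8 * w i ^ 2 + t₃ * z i ^ 8 + z i ^ 6 + t₁ * z i ^ 4 + t₁ ^ 2 * z i ^ 2 +
        t₀ ^ 2 * w i ^ 2 + c₃ * z i)
    (r := C (z i) ^ 8 * C (w i) ^ 4 + C (w i) ^ 8 * X ^ 4 * C (z i) ^ 4 +
        X ^ 4 * C (w i) ^ 8 * X ^ 4 * C (w i) ^ 4 +
      X * (C (w i) ^ 8 * X ^ 4) * (C (z i) ^ 2 + C (w i) ^ 2 * X ^ 2) +
      q * C (z i) ^ 8 + C (w i) ^ 8 * X ^ 4 *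
        (C t₀ + C t₁ * X + C t₂ * X ^ 2 + C t₃ * X ^ 3 + X ^ 4 * q) +
      X * C (w i) ^ 2 * C (z i) ^ 4 + X ^ 3 * C (w i) ^ 4 * (C (z i) ^ 2 + C (w i) ^ 2 * X ^ 2) +
      (C (z i) ^ 4 + X ^ 4 * C (w i) ^ 4) +
      X ^ 2 * (C t₀ + C t₁ * X + C t₂ * X ^ 2 + C t₃ * X ^ 3 + X ^ 4 * q) * C (w i) ^ 4 +
      (C t₂ + C t₃ * X + X ^ 2 * q) * C (z i) ^ 4 +
      ((C t₂ ^ 2 + C t₃ ^ 2 * X ^ 2 + X ^ 4 * q ^ 2) * C (z i) ^ 4 +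
        (C t₀ ^ 2 + C t₁ ^ 2 * X ^ 2 + X ^ 4 * (C t₂ ^ 2 + C t₃ ^ 2 * X ^ 2 + X ^ 4 * q ^ 2)) *
          C (w i) ^ 4) +
      (X * C t₁ ^ 2 * C (w i) ^ 2 + X * (C t₂ ^ 2 + C t₃ ^ 2 * X ^ 2 + X ^ 4 * q ^ 2) *
        (C (z i) ^ 2 + C (w i) ^ 2 * X ^ 2)) +
      X * (C (z i) ^ 2 + C (w i) ^ 2 * X ^ 2) +
      (C c₃ * C (w i) + q₃ * (C (z i) + C (w i) * X))) (by
      simp only [map_add, map_mul, map_pow]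
      rw [← key, map_zero]
      ring)
  exact ⟨e0, e1, e2, e3⟩

lemma reduced_coeff_relation {z w u c t₃ c₃ : E}
    (h0 : z ^ 12 + u ^ 4 * z ^ 8 + u ^ 8 * z ^ 4 + c * z = 0)
    (h1 : z ^ 10 + u ^ 2 * z ^ 8 + u ^ 8 * z ^ 2 + c * w = 0)
    (h3 : z ^ 8 * w ^ 2 + t₃ * z ^ 8 + z ^ 6 + u ^ 2 * z ^ 4 + u ^ 4 * z ^ 2 +
      u ^ 8 * w ^ 2 + c₃ * z = 0) :
    (u ^ 20 + c ^ 2 * t₃) * z ^ 8 + (u ^ 24 + u ^ 2 * c ^ 2) * z ^ 4 + c ^ 2 * c₃ * z = 0 := by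
  have h2 : (2 : E) = 0 := CharTwo.two_eq_zero
  linear_combination c ^ 2 * h3 + (z ^ 8 + u ^ 8) *
    (z ^ 10 + u ^ 2 * z ^ 8 + u ^ 8 * z ^ 2 + c * w) * h1 +
    (z ^ 16 + c * z ^ 5 + u ^ 12 * z ^ 4 + c * u ^ 4 * z) * h0 -
    (c ^ 2 * w ^ 2 * z ^ 8 + c ^ 2 * z ^ 6 + c ^ 2 * u ^ 4 * z ^ 2 + c ^ 2 * u ^ 8 * w ^ 2 +
      z ^ 28 + u ^ 2 * z ^ 26 + 2 * u ^ 8 * z ^ 20 + c * w * z ^ 18 + u ^ 4 * z ^ 24 +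
      2 * u ^ 10 * z ^ 18 + c * u ^ 2 * w * z ^ 16 + 2 * u ^ 16 * z ^ 12 +
      2 * c * u ^ 8 * w * z ^ 10 + u ^ 12 * z ^ 16 + u ^ 18 * z ^ 10 + c * u ^ 10 * w * z ^ 8 +
      c * u ^ 16 * w * z ^ 2 + c * z ^ 17 + c * u ^ 4 * z ^ 13 + c * u ^ 8 * z ^ 9 +
      c * u ^ 12 * z ^ 5) * h2

/-- When the second symmetric function of the linear forms is the variable, their coefficient
vectors, together with the origin, lie on a hyperbola and its nucleus. -/
lemma exists_hyperbola_center [IsAlgClosed E] (z w : Fin 11 → E)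
    (hD : DicksonRelations fun i => C (z i) + C (w i) * X)
    (h2 : esymmFam (fun i => C (z i) + C (w i) * X) 2 = X)
    (hw : ∀ i, z i = 0 → w i ≠ 0) (hz : ∀ i j, z i = 0 → z j = 0 → i = j)
    (hzw : ∀ i j, z i = z j → w i = w j → i = j) :
    ∃ u v : E, (∀ i, (z i = u ∧ w i = v) ∨ (z i + u) * (w i + v) = 1) ∧
      ((u = 0 ∧ v = 0) ∨ (u * v = 1 ∧ ∃ i, z i = u ∧ w i = v)) := by
  obtain ⟨c, c₃, t₀, t₁, t₂, t₃, hc, hz0, hrel⟩ := exists_coeff_relations z w hD h2 hw hz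
  have hinj : Function.Injective z := by
    intro i j hij
    refine hzw i j hij (mul_left_cancel₀ hc ?_)
    have hi := (hrel i).2.1
    have hj := (hrel j).2.1
    rw [hij] at hi
    linear_combination hi - hj
  have hlin : ∀ i, t₂ * z i ^ 4 = t₀ + t₁ ^ 2 := fun i => by
    have hne := pow_ne_zero 4 (hz0 i)
    refine mul_right_cancel₀ hne (CharTwo.add_eq_zero.1 ?_)
    linear_combination (hrel i).2.2.1
  have ht₂ : t₂ = 0 := by
    have h : t₂ * (z 0 + z 1) ^ 4 = 0 := by
      rw [show (z 0 + z 1) ^ 4 = ((z 0 + z 1) ^ 2) ^ 2 by ring, CharTwo.add_sq, CharTwo.add_sq]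
      linear_combination hlin 0 + hlin 1 + CharTwo.add_self_eq_zero (t₀ + t₁ ^ 2)
    refine (mul_eq_zero.1 h).resolve_right (pow_ne_zero 4 fun h => ?_)
    exact absurd (hinj (CharTwo.add_eq_zero.1 h)) (by decide)
  have ht₀ : t₀ = t₁ ^ 2 := CharTwo.add_eq_zero.1 (by rw [← hlin 0, ht₂, zero_mul])
  obtain ⟨u, hu⟩ := IsAlgClosed.exists_pow_nat_eq t₁ (n := 2) (by norm_num)
  subst ht₀
  subst hu
  have h0 : ∀ i, z i ^ 12 + u ^ 4 * z i ^ 8 + u ^ 8 * z i ^ 4 + c * z i = 0 := fun i => by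
    linear_combination (hrel i).1
  have h1 : ∀ i, z i ^ 10 + u ^ 2 * z i ^ 8 + u ^ 8 * z i ^ 2 + c * w i = 0 := fun i => by
    linear_combination (hrel i).2.1
  have hB := coeff_eq_zero_of_many_zeros hinj fun i =>
    reduced_coeff_relation (t₃ := t₃) (c₃ := c₃) (h0 i) (h1 i) (by linear_combination (hrel i).2.2.2)
  have huc : u ^ 12 = u * c := by
    refine CharTwo.sq_inj.1 (CharTwo.add_eq_zero.1 ?_)
    linear_combination hB
  have hadd8 : ∀ a : E, (a + u) ^ 8 = a ^ 8 + u ^ 8 := fun a => by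
    rw [show (a + u) ^ 8 = (((a + u) ^ 2) ^ 2) ^ 2 by ring, CharTwo.add_sq, CharTwo.add_sq,
      CharTwo.add_sq]
    ring
  have hadd4 : ∀ a : E, (a + u) ^ 4 = a ^ 4 + u ^ 4 := fun a => by
    rw [show (a + u) ^ 4 = ((a + u) ^ 2) ^ 2 by ring, CharTwo.add_sq, CharTwo.add_sq]
    ring
  obtain ⟨v, hv⟩ : ∃ v, c * v = u ^ 10 := ⟨u ^ 10 / c, mul_div_cancel₀ _ hc⟩
  have h12 : ∀ i, (z i + u) ^ 12 = c * (z i + u) := fun i => by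
    rw [show (z i + u) ^ 12 = (z i + u) ^ 8 * (z i + u) ^ 4 by ring, hadd8, hadd4]
    exact CharTwo.add_eq_zero.1 (by
      linear_combination h0 i + huc + CharTwo.add_self_eq_zero (u * c))
  have h10 : ∀ i, (z i + u) ^ 10 = c * (w i + v) := fun i => by
    rw [show (z i + u) ^ 10 = (z i + u) ^ 8 * (z i + u) ^ 2 by ring, hadd8, CharTwo.add_sq]
    exact CharTwo.add_eq_zero.1 (by
      linear_combination h1 i + hv + CharTwo.add_self_eq_zero (u ^ 10))
  have h11 : ∀ i, z i ≠ u → (z i + u) ^ 11 = c := fun i hi => by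
    refine mul_right_cancel₀ (b := z i + u) (fun h => hi (CharTwo.add_eq_zero.1 h)) ?_
    rw [← h12 i]; ring
  have hwu : ∀ i, z i = u → w i = v := fun i hi => by
    have h := h10 i
    rw [hi, CharTwo.add_self_eq_zero, zero_pow (by norm_num), eq_comm, mul_eq_zero] at h
    exact CharTwo.add_eq_zero.1 (h.resolve_left hc)
  refine ⟨u, v, fun i => ?_, ?_⟩
  · by_cases hi : z i = u
    · exact .inl ⟨hi, hwu i hi⟩
    · refine .inr (mul_left_cancel₀ hc ?_)
      calc c * ((z i + u) * (w i + v)) = (z i + u) * (c * (w i + v)) := by ring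
        _ = (z i + u) ^ 11 := by rw [← h10]; ring
        _ = c * 1 := by rw [h11 i hi, mul_one]
  · by_cases hu : u = 0
    · exact .inl ⟨hu, by simpa [hu, hc] using hv⟩
    have hcu : c = u ^ 11 := mul_left_cancel₀ hu (by rw [← huc]; ring)
    refine .inr ⟨mul_left_cancel₀ hc (by rw [mul_one, mul_left_comm, hv, hcu]; ring), ?_⟩
    by_contra! hne
    have hzu : ∀ i, z i ≠ u := fun i hi => hne i hi (hwu i hi)
    have hpoly : (X + C u) ^ 11 - C c = 0 := by
      have hinj' : Function.Injective (Option.elim · 0 z : Option (Fin 11) → E) := by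
        rintro (_ | i) (_ | j) h
        · rfl
        · exact absurd h.symm (hz0 j)
        · exact absurd h (hz0 i)
        · exact congrArg some (hinj h)
      refine eq_zero_of_natDegree_lt_card_of_eval_eq_zero _ hinj' (fun i => ?_) ?_
      · rcases i with _ | i
        · simp [hcu]
        · simp [h11 i (hzu i)]
      · refine lt_of_le_of_lt (b := 11) (by compute_degree) (by simp)
    have := congrArg (eval u) hpoly
    simp [CharTwo.add_self_eq_zero] at this
    exact hc this

end LocalExpansion

section ChangeOfCoordinates

open Finset Polynomial

variable {E : Type*} [Field E]

/-- The relations are preserved by a homogeneous change of variables. -/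
lemma DicksonRelations.substitute {a b : Fin 11 → E}
    (hD : DicksonRelations fun i => C (a i) * X + C (b i)) {α β γ : E}
    (h2 : esymmFam (fun i => C (a i) * X + C (b i)) 2 = C α * X ^ 2 + C β * X + C γ)
    (U : E[X]) {V : E[X]} (hV : V ≠ 0) :
    DicksonRelations (fun i => C (a i) * U + C (b i) * V) ∧
      esymmFam (fun i => C (a i) * U + C (b i) * V) 2 =
        C α * U ^ 2 + C β * (U * V) + C γ * V ^ 2 := by
  let ι : E[X] →+* FractionRing E[X] := algebraMap E[X] (FractionRing E[X])
  have hι : Function.Injective ι := IsFractionRing.injective E[X] (FractionRing E[X])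
  have hV' : ι V ≠ 0 := by rwa [Ne, map_eq_zero_iff _ hι]
  let φ : E[X] →+* FractionRing E[X] := eval₂RingHom (ι.comp C) (ι U / ι V)
  have hC : ∀ t, φ (C t) = ι (C t) := fun t => by simp [φ]
  have hX : φ X = ι U / ι V := by simp [φ]
  have hφ : (fun i => ι V * φ (C (a i) * X + C (b i))) =
      fun i => ι (C (a i) * U + C (b i) * V) := by
    funext i
    simp only [map_add, map_mul, hC, hX]
    field_simp
  constructor
  · exact .of_map hι (hφ ▸ (hD.map φ).const_mul (ι V))
  · apply hι
    have h := congrArg (fun p => ι V ^ 2 * φ p) h2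
    simp only [map_esymmFam φ] at h
    rw [← esymmFam_smul, hφ, ← map_esymmFam ι] at h
    rw [h]
    simp only [map_add, map_mul, map_pow, hC, hX]
    field_simp

lemma exists_center_of_esymm_two [CharP E 2] [IsAlgClosed E] {a b : Fin 11 → E}
    (hD : DicksonRelations fun i => C (a i) * X + C (b i)) {α β γ : E}
    (h2 : esymmFam (fun i => C (a i) * X + C (b i)) 2 = C α * X ^ 2 + C β * X + C γ)
    (hne : C α * X ^ 2 + C β * X + C γ ≠ 0) (ha : ∀ i, a i ≠ 0)
    (hab : ∀ i j, a i * b j = a j * b i → i = j) :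
    β ≠ 0 ∧ ((∀ i, γ * a i ^ 2 + β * (a i * b i) + α * b i ^ 2 = β ^ 2) ∨
      ∃ j, γ * a j ^ 2 + β * (a j * b j) + α * b j ^ 2 = β ^ 2 ∧ ∀ i, i ≠ j →
        γ * (a i - a j) ^ 2 + β * ((a i - a j) * (b i - b j)) + α * (b i - b j) ^ 2 = β ^ 2) := by
  have two : (2 : E) = 0 := CharTwo.two_eq_zero
  have two' : (2 : E[X]) = 0 := CharTwo.two_eq_zero
  have main : ∀ θ ν θ' ν' : E, θ * ν' + θ' * ν ≠ 0 →
      DicksonRelations (fun i => C (a i * θ + b i * ν) + C (a i * θ' + b i * ν') * X) ∧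
      esymmFam (fun i => C (a i * θ + b i * ν) + C (a i * θ' + b i * ν') * X) 2 =
        C (α * θ ^ 2 + β * θ * ν + γ * ν ^ 2) + C (β * (θ * ν' + θ' * ν)) * X +
          C (α * θ' ^ 2 + β * θ' * ν' + γ * ν' ^ 2) * X ^ 2 ∧
      (∀ i, a i * θ + b i * ν = 0 → a i * θ' + b i * ν' ≠ 0) ∧
      (∀ i j, a i * θ + b i * ν = 0 → a j * θ + b j * ν = 0 → i = j) ∧
      (∀ i j, a i * θ + b i * ν = a j * θ + b j * ν →
        a i * θ' + b i * ν' = a j * θ' + b j * ν' → i = j) := by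
    intro θ ν θ' ν' hδ
    have hV : C ν + C ν' * X ≠ 0 := by
      intro h
      have h0 := congrArg (fun p => coeff p 0) h
      have h1 := congrArg (fun p => coeff p 1) h
      simp [coeff_C] at h0 h1
      simp [h0, h1] at hδ
    obtain ⟨hD', h2'⟩ := hD.substitute h2 (C θ + C θ' * X) hV
    have hfam : (fun i => C (a i) * (C θ + C θ' * X) + C (b i) * (C ν + C ν' * X)) =
        fun i => C (a i * θ + b i * ν) + C (a i * θ' + b i * ν') * X := by
      funext i
      simp only [map_add, map_mul]
      ring
    rw [hfam] at hD' h2'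
    refine ⟨hD', ?_, fun i h h' => ?_, fun i j hi hj => ?_, fun i j h h' => ?_⟩
    · rw [h2']
      simp only [map_add, map_mul, map_pow]
      linear_combination (C α * C θ * C θ' * X + C γ * C ν * C ν' * X) * two'
    · refine mul_ne_zero (ha i) hδ ?_
      linear_combination ν' * h + ν * h' - b i * ν * ν' * two
    · refine hab i j ?_
      by_cases hθ : θ = 0
      · have hν : ν ≠ 0 := by rintro rfl; simp [hθ] at hδ
        exact mul_right_cancel₀ hν (by linear_combination a i * hj - a j * hi)
      · exact mul_right_cancel₀ hθ (by linear_combination b j * hi - b i * hj)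
    · have h1 : a i = a j := mul_right_cancel₀ hδ (by
        linear_combination ν' * h + ν * h' - (b i - b j) * ν * ν' * two)
      have h3 : b i = b j := mul_right_cancel₀ hδ (by
        linear_combination θ' * h + θ * h' - (a i - a j) * θ * θ' * two)
      exact hab i j (by rw [h1, h3])
  have hβ : β ≠ 0 := by
    rintro rfl
    by_cases hα : α = 0
    · have hγ : γ ≠ 0 := by rintro rfl; simp [hα] at hne
      obtain ⟨hD', h2', hw, hz, -⟩ := main 1 0 0 1 (by simp)
      exact esymm_two_ne_const_mul_sq _ _ hD' hγ hw hz (by rw [h2']; simp [hα])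
    · obtain ⟨θ, hθ⟩ := IsAlgClosed.exists_pow_nat_eq (γ / α) (n := 2) (by norm_num)
      obtain ⟨hD', h2', hw, hz, -⟩ := main θ 1 1 0 (by simp)
      refine esymm_two_ne_const_mul_sq _ _ hD' hα hw hz ?_
      rw [h2', hθ, mul_div_cancel₀ _ hα, show α * 1 ^ 2 + 0 * 1 * 0 + γ * 0 ^ 2 = α by ring,
        show γ + 0 * θ * 1 + γ * 1 ^ 2 = 0 by linear_combination γ * two]
      simp
  obtain ⟨θ, hθ⟩ : ∃ θ, α * θ ^ 2 + β * θ + γ = 0 := by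
    obtain ⟨θ, hθ⟩ := IsAlgClosed.exists_root (C α * X ^ 2 + C β * X + C γ) fun h => by
      have h1 := congrArg (fun p => coeff p 1) (eq_C_of_degree_eq_zero h)
      simp [coeff_X, coeff_C] at h1
      exact hβ h1
    exact ⟨θ, by simpa using hθ⟩
  obtain ⟨ν, hν⟩ : ∃ ν, ν * β ^ 2 = α := ⟨_, div_mul_cancel₀ α (pow_ne_zero 2 hβ)⟩
  have hβi : β⁻¹ * β = 1 := inv_mul_cancel₀ hβ
  have hδ : θ * ν + (θ * ν + β⁻¹) * 1 = β⁻¹ := by linear_combination θ * ν * two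
  obtain ⟨hD', h2', hw, hz, hzw⟩ := main θ 1 (θ * ν + β⁻¹) ν (by rw [hδ]; exact inv_ne_zero hβ)
  have hX : esymmFam (fun i => C (a i * θ + b i * 1) + C (a i * (θ * ν + β⁻¹) + b i * ν) * X) 2 =
      X := by
    rw [h2', hδ, mul_inv_cancel₀ hβ, show α * θ ^ 2 + β * θ * 1 + γ * 1 ^ 2 = 0 by
      linear_combination hθ, show α * (θ * ν + β⁻¹) ^ 2 + β * (θ * ν + β⁻¹) * ν + γ * ν ^ 2 = 0 by
      linear_combination ν ^ 2 * hθ + α * θ * ν * β⁻¹ * two - β⁻¹ ^ 2 * hν +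
        ν * (β⁻¹ * β + 2) * hβi + ν * two]
    simp
  have hq : ∀ s t : E, (s * θ + t * 1) * (s * (θ * ν + β⁻¹) + t * ν) = 1 →
      γ * s ^ 2 + β * (s * t) + α * t ^ 2 = β ^ 2 := fun s t h => by
    linear_combination β ^ 2 * h - (s * θ + t) ^ 2 * hν - β * s * (s * θ + t) * hβi - s ^ 2 * hθ +
      (γ * s ^ 2 - α * s * t * θ) * two
  obtain ⟨u, v, h, h0⟩ := exists_hyperbola_center _ _ hD' hX hw hz hzw
  refine ⟨hβ, ?_⟩
  rcases h0 with ⟨rfl, rfl⟩ | ⟨huv, j, rfl, rfl⟩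
  · refine .inl fun i => hq _ _ ?_
    rcases h i with ⟨h1, h2⟩ | h
    · exact absurd h2 (hw i h1)
    · simpa only [add_zero] using h
  · refine .inr ⟨j, hq _ _ huv, fun i hi => hq _ _ ?_⟩
    rcases h i with ⟨h1, h2⟩ | h
    · exact absurd (hzw i j h1 h2) hi
    · rw [CharTwo.sub_eq_add, CharTwo.sub_eq_add]
      linear_combination h

end ChangeOfCoordinates

section SlopeSets

open Finset Polynomial

lemma exists_center_of_slopes {F : Type*} [Field F] [Fintype F] [CharP F 2]
    (hF : Fintype.card F = 32) (x y : Fin 11 → F) (D : Finset F) (hD : D.card = 11)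
    (hp : ∀ d ∈ D, ∀ k, 0 < k → ∑ i, (x i * d + y i) ^ k = 0)
    (hn : ∀ d ∉ D, ∀ i, x i * d + y i ≠ 0) (hx : ∀ i, x i ≠ 0)
    (hxy : ∀ i j, x i * y j = x j * y i → i = j) :
    ∃ α β γ : F, β ≠ 0 ∧ ((∀ i, γ * x i ^ 2 + β * (x i * y i) + α * y i ^ 2 = β ^ 2) ∨
      ∃ j, γ * x j ^ 2 + β * (x j * y j) + α * y j ^ 2 = β ^ 2 ∧ ∀ i, i ≠ j →
        γ * (x i - x j) ^ 2 + β * ((x i - x j) * (y i - y j)) + α * (y i - y j) ^ 2 =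
          β ^ 2) := by
  obtain ⟨hrel, hne⟩ := dicksonRelations_of_slopes hF x y D hD hp hn
  have hdeg := natDegree_esymmFam_le (fun i => C (x i) * X + C (y i))
    (fun i => natDegree_linear_le) 2
  obtain ⟨α, β, γ, h2⟩ : ∃ α β γ : F, esymmFam (fun i => C (x i) * X + C (y i)) 2 =
      C α * X ^ 2 + C β * X + C γ :=
    ⟨_, _, _, eq_quadratic_of_degree_le_two (natDegree_le_iff_degree_le.1 hdeg)⟩
  let ι := algebraMap F (AlgebraicClosure F)
  have hι : Function.Injective ι := ι.injective
  have : CharP (AlgebraicClosure F) 2 := charP_of_injective_ringHom hι 2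
  have hfam : (fun i => mapRingHom ι (C (x i) * X + C (y i))) =
      fun i => C (ι (x i)) * X + C (ι (y i)) := by
    funext i
    simp
  have hrel' := hrel.map (mapRingHom ι)
  have h2' := congrArg (mapRingHom ι) h2
  have hne' := (map_ne_zero_iff (mapRingHom ι) (map_injective ι hι)).2 hne
  rw [h2] at hne'
  rw [map_esymmFam] at h2'
  rw [hfam] at hrel' h2'
  obtain ⟨hβ, h⟩ := exists_center_of_esymm_two (α := ι α) (β := ι β) (γ := ι γ) hrel'
    (by simpa using h2') (by simpa using hne') (fun i => by simpa using hx i)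
    (fun i j h => hxy i j (hι (by simpa using h)))
  refine ⟨α, β, γ, (map_ne_zero_iff _ hι).1 hβ, h.imp (fun h i => hι (by simpa using h i)) ?_⟩
  rintro ⟨j, h0, h⟩
  exact ⟨j, hι (by simpa using h0), fun i hi => hι (by simpa using h i hi)⟩

/-- Twelve points of an affine plane of order 32, no three of them on a line, which determine only
eleven directions: all but one of them lie on an ellipse, hyperbola or parabola whose nucleus is
the remaining one. -/
lemma exists_quadratic_relation_of_slopes {F : Type*} [Field F] [Fintype F]
    (hF : Fintype.card F = 32) {X Y : Fin 12 → F} {D : Finset F} (hX : Function.Injective X)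
    (hslope : ∀ i j, i ≠ j → (Y i - Y j) / (X i - X j) ∈ D)
    (harc : ∀ i j k, i ≠ j → i ≠ k →
      (Y i - Y j) / (X i - X j) = (Y i - Y k) / (X i - X k) → j = k)
    (hD : D.card ≤ 11) :
    ∃ (α β γ : F) (n : Fin 12), β ≠ 0 ∧ ∀ k, k ≠ n →
      γ * (X k - X n) ^ 2 + β * ((X k - X n) * (Y k - Y n)) + α * (Y k - Y n) ^ 2 = β ^ 2 := by
  classical
  have := charP_two_of_card_eq hF
  have two : (2 : F) = 0 := CharTwo.two_eq_zero
  have hsub : ∀ i j, i ≠ j → X i - X j ≠ 0 := fun i j h => sub_ne_zero.2 (hX.ne h)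
  have himage : ∀ i, (univ.erase i).image (fun j => (Y i - Y j) / (X i - X j)) = D ∧
      D.card = 11 := by
    intro i
    have hc : ((univ.erase i).image fun j => (Y i - Y j) / (X i - X j)).card = 11 := by
      rw [card_image_of_injOn fun j hj k hk h =>
        harc i j k (ne_of_mem_erase hj).symm (ne_of_mem_erase hk).symm h]
      simp
    have hs : (univ.erase i).image (fun j => (Y i - Y j) / (X i - X j)) ⊆ D := by
      intro d hd
      obtain ⟨j, hj, rfl⟩ := mem_image.1 hd
      exact hslope i j (ne_of_mem_erase hj).symm
    have := eq_of_subset_of_card_le hs (by omega)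
    exact ⟨this, this ▸ hc⟩
  have hpartner : ∀ d ∈ D, ∀ i, ∃ j, i ≠ j ∧ (Y i - Y j) / (X i - X j) = d := by
    intro d hd i
    rw [← (himage i).1] at hd
    obtain ⟨j, hj, h⟩ := mem_image.1 hd
    exact ⟨j, (ne_of_mem_erase hj).symm, h⟩
  have hsymm : ∀ i j, (Y i - Y j) / (X i - X j) = (Y j - Y i) / (X j - X i) := fun i j => by
    rw [← neg_sub (Y j), ← neg_sub (X j), neg_div_neg_eq]
  set x : Fin 11 → F := fun i => X i.succ - X 0 with hx
  set y : Fin 11 → F := fun i => Y i.succ - Y 0 with hy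
  have hp : ∀ d ∈ D, ∀ k, 0 < k → ∑ i, (x i * d + y i) ^ k = 0 := by
    intro d hd k hk
    have hsum : ∑ i, ((X i - X 0) * d + (Y i - Y 0)) ^ k = 0 := by
      choose g hg hgd using hpartner d hd
      refine sum_involution (fun i _ => g i) (fun i _ => ?_) (fun i _ _ => (hg i).symm)
        (fun _ _ => mem_univ _) fun i _ => ?_
      · have h := hgd i
        rw [div_eq_iff (hsub _ _ (hg i))] at h
        rw [show (X i - X 0) * d + (Y i - Y 0) = (X (g i) - X 0) * d + (Y (g i) - Y 0) by
          linear_combination -h + (Y i - Y (g i)) * two]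
        exact CharTwo.add_self_eq_zero _
      · refine harc (g i) _ _ (hg (g i)) (hg i).symm ?_
        rw [hgd, hsymm, hgd]
    rw [Fin.sum_univ_succ, sub_self, sub_self, zero_mul, add_zero, zero_pow hk.ne', zero_add]
      at hsum
    exact hsum
  have hn : ∀ d ∉ D, ∀ i, x i * d + y i ≠ 0 := by
    intro d hd i h
    refine hd ?_
    have hne : i.succ ≠ 0 := Fin.succ_ne_zero i
    have := hslope i.succ 0 hne
    rwa [show (Y i.succ - Y 0) / (X i.succ - X 0) = d by
      rw [div_eq_iff (hsub _ _ hne)]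
      linear_combination h - (X i.succ - X 0) * d * two] at this
  have hx0 : ∀ i, x i ≠ 0 := fun i => hsub _ _ (Fin.succ_ne_zero i)
  have hxy : ∀ i j, x i * y j = x j * y i → i = j := by
    intro i j h
    refine Fin.succ_injective _ (harc 0 _ _ (Fin.succ_ne_zero i).symm (Fin.succ_ne_zero j).symm ?_)
    rw [hsymm, hsymm 0, div_eq_div_iff (hx0 i) (hx0 j)]
    linear_combination -h
  obtain ⟨α, β, γ, hβ, h⟩ :=
    exists_center_of_slopes hF x y D (himage 0).2 hp hn hx0 hxy
  rcases h with h | ⟨j, h0, h⟩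
  · refine ⟨α, β, γ, 0, hβ, fun k hk => ?_⟩
    obtain ⟨i, rfl⟩ := Fin.exists_succ_eq.2 hk
    exact h i
  · refine ⟨α, β, γ, j.succ, hβ, fun k hk => ?_⟩
    rcases Fin.eq_zero_or_eq_succ k with rfl | ⟨i, rfl⟩
    · rw [← h0]
      ring
    · simpa [hx, hy] using h i (by rintro rfl; exact hk rfl)

end SlopeSets

section Conics

open MvPolynomial

/-- The ternary quadratic form `X₀² + γ X₁² + β X₁ X₂ + α X₂²`; in characteristic two and for
`β ≠ 0`, its conic has nucleus `(1 : 0 : 0)`. -/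
noncomputable def standardQuadric (α β γ : F) : MvPolynomial (Fin 3) F :=
  X 0 ^ 2 + C γ * X 1 ^ 2 + C β * (X 1 * X 2) + C α * X 2 ^ 2

lemma isHomogeneous_standardQuadric (α β γ : F) : (standardQuadric α β γ).IsHomogeneous 2 := by
  have hX : ∀ i : Fin 3, (X i : MvPolynomial (Fin 3) F).IsHomogeneous 1 := isHomogeneous_X F
  have hC : ∀ (c : F) {p : MvPolynomial (Fin 3) F}, p.IsHomogeneous 2 →
      (C c * p).IsHomogeneous 2 := fun c p hp => by
    simpa using (isHomogeneous_C (Fin 3) c).mul hp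
  exact ((((hX 0).pow 2).add (hC γ ((hX 1).pow 2))).add (hC β ((hX 1).mul (hX 2)))).add
    (hC α ((hX 2).pow 2))

lemma irreducible_standardQuadric [CharP F 2] (α γ : F) {β : F} (hβ : β ≠ 0) :
    Irreducible (standardQuadric α β γ) := by
  set g : MvPolynomial (Fin 2) F := C γ * X 0 ^ 2 + C β * (X 0 * X 1) + C α * X 1 ^ 2 with hg
  have hmap : finSuccEquiv F 2 (standardQuadric α β γ) = Polynomial.X ^ 2 + Polynomial.C g := by
    have h1 : finSuccEquiv F 2 (X 1) = Polynomial.C (X 0) := finSuccEquiv_X_succ (j := 0)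
    have h2 : finSuccEquiv F 2 (X 2) = Polynomial.C (X 1) := finSuccEquiv_X_succ (j := 1)
    have hC : ∀ c : F, finSuccEquiv F 2 (C c) = Polynomial.C (C c) := fun c => by
      simp [finSuccEquiv_apply]
    simp only [standardQuadric, map_add, map_mul, map_pow, h1, h2, hC, finSuccEquiv_X_zero, hg]
    ring
  rw [← MulEquiv.irreducible_iff (finSuccEquiv F 2), hmap]
  have hdeg : (Polynomial.X ^ 2 + Polynomial.C g).natDegree = 2 :=
    Polynomial.natDegree_X_pow_add_C
  rw [(Polynomial.monic_X_pow_add_C g two_ne_zero).irreducible_iff_roots_eq_zero_of_degree_le_three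
    hdeg.ge (by omega)]
  refine Multiset.eq_zero_of_forall_notMem fun p hp => ?_
  have hroot : p ^ 2 + g = 0 := by simpa using Polynomial.isRoot_of_mem_roots hp
  have h0 := congrArg (pderiv (0 : Fin 2)) hroot
  have two : (2 : MvPolynomial (Fin 2) F) = 0 := CharTwo.two_eq_zero
  have h10 : pderiv (0 : Fin 2) (X 1 : MvPolynomial (Fin 2) F) = 0 :=
    pderiv_X_of_ne (by decide)
  simp only [hg, pow_two, map_add, Derivation.leibniz, h10, pderiv_C, pderiv_X_self,
    smul_eq_mul, map_zero] at h0
  have h1 : C β * X 1 = (0 : MvPolynomial (Fin 2) F) := by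
    linear_combination h0 - (p * pderiv 0 p + C γ * X 0) * two
  rcases mul_eq_zero.1 h1 with h1 | h1
  · exact hβ (C_eq_zero.1 h1)
  · exact X_ne_zero 1 h1

/-- A linear change of coordinates carries the standard conic to a conic. -/
lemma isConic_of_coordinates [CharP F 2] (α γ : F) {β : F} (hβ : β ≠ 0)
    (G : (Fin 3 → F) ≃ₗ[F] (Fin 3 → F)) :
    IsConic {P : PG2 F | G P.rep 0 ^ 2 + γ * G P.rep 1 ^ 2 + β * (G P.rep 1 * G P.rep 2) +
      α * G P.rep 2 ^ 2 = 0} := by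
  set L : Matrix (Fin 3) (Fin 3) F → Fin 3 → MvPolynomial (Fin 3) F :=
    fun M i => ∑ j, C (M i j) * X j with hL
  have hcomp : ∀ M M' : Matrix (Fin 3) (Fin 3) F, M * M' = 1 →
      (aeval (L M')).comp (aeval (L M)) = AlgHom.id F (MvPolynomial (Fin 3) F) := by
    intro M M' h
    refine algHom_ext fun i => ?_
    have hi : ∀ k, ∑ j, M i j * M' j k = if i = k then 1 else 0 := fun k => by
      rw [← Matrix.mul_apply, h, Matrix.one_apply]
    simp only [hL, AlgHom.comp_apply, aeval_X, map_sum, map_mul, algHom_C, algebraMap_eq,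
      Finset.mul_sum, AlgHom.id_apply]
    rw [Finset.sum_comm]
    simp only [← mul_assoc, ← Finset.sum_mul, ← map_mul, ← map_sum, hi]
    simp
  set M := LinearMap.toMatrix' G.toLinearMap with hM
  set M' := LinearMap.toMatrix' G.symm.toLinearMap with hM'
  have hMM' : M * M' = 1 := by
    rw [hM, hM', ← LinearMap.toMatrix'_comp]
    simp
  let φ : MvPolynomial (Fin 3) F ≃ₐ[F] MvPolynomial (Fin 3) F :=
    .ofAlgHom (aeval (L M)) (aeval (L M')) (hcomp M' M (mul_eq_one_comm.1 hMM')) (hcomp M M' hMM')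
  have hφ : ∀ p, φ p = aeval (L M) p := fun _ => rfl
  have heval : ∀ v i, eval v (L M i) = G v i := fun v i => by
    have h := congrFun (LinearMap.toMatrix'_mulVec G.toLinearMap v) i
    rw [LinearEquiv.coe_coe] at h
    rw [← h]
    simp [hL, hM, Matrix.mulVec, dotProduct]
  refine ⟨φ (standardQuadric α β γ), ?_, (MulEquiv.irreducible_iff φ).2
    (irreducible_standardQuadric α γ hβ), ?_⟩
  · rw [hφ]
    simpa using (isHomogeneous_standardQuadric α β γ).aeval (L M) (n := 1) fun i =>
      IsHomogeneous.sum _ _ _ fun j _ => by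
        simpa using (isHomogeneous_C (Fin 3) (M i j)).mul (isHomogeneous_X F j)
  · ext P
    simp only [Set.mem_ofPred_eq, hφ, standardQuadric, map_add, map_mul, map_pow, aeval_X, algHom_C,
      algebraMap_eq, eval_C, heval]

lemma exists_rep_mk_eq_smul {v : Fin 3 → F} (hv : v ≠ 0) :
    ∃ c : F, c ≠ 0 ∧ (Projectivization.mk F v hv).rep = c • v := by
  obtain ⟨c, hc⟩ := Projectivization.exists_smul_eq_mk_rep F v hv
  exact ⟨c, c.ne_zero, by rw [← hc]; rfl⟩

lemma apply_rep_mk_eq_zero_iff (h : (Fin 3 → F) →ₗ[F] F) {v : Fin 3 → F} (hv : v ≠ 0) :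
    h (Projectivization.mk F v hv).rep = 0 ↔ h v = 0 := by
  obtain ⟨c, hc, hr⟩ := exists_rep_mk_eq_smul hv
  rw [hr, map_smul, smul_eq_mul, mul_eq_zero, or_iff_right hc]

/-- In characteristic two, a nondegenerate binary quadratic form with a zero has two. -/
lemma exists_second_zero [CharP F 2] {α β γ a b : F} (hβ : β ≠ 0) (hab : a ≠ 0 ∨ b ≠ 0)
    (h : γ * a ^ 2 + β * (a * b) + α * b ^ 2 = 0) :
    ∃ a' b', a * b' - b * a' ≠ 0 ∧ γ * a' ^ 2 + β * (a' * b') + α * b' ^ 2 = 0 := by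
  have two : (2 : F) = 0 := CharTwo.two_eq_zero
  by_cases hb : b = 0
  · have ha : a ≠ 0 := hab.resolve_right (not_not.2 hb)
    subst hb
    refine ⟨α * a, β * a, ?_, ?_⟩
    · simp [ha, hβ]
    · linear_combination α ^ 2 * h + α * β ^ 2 * a ^ 2 * two
  · refine ⟨β * b + γ * a, γ * b, ?_, ?_⟩
    · rw [show a * (γ * b) - b * (β * b + γ * a) = -(β * b ^ 2) by ring]
      simp [hb, hβ]
    · linear_combination γ ^ 2 * h + (γ * β ^ 2 * b ^ 2 + γ ^ 2 * β * a * b) * two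

/-- In characteristic two, all tangent lines of the conic `X₀² + γ X₁² + β X₁ X₂ + α X₂² = 0`
pass through `(1 : 0 : 0)`. -/
lemma mem_of_isTangentLine [CharP F 2] {α β γ : F} (hβ : β ≠ 0)
    (G : (Fin 3 → F) ≃ₗ[F] (Fin 3 → F)) {N : PG2 F} (hN₁ : G N.rep 1 = 0) (hN₂ : G N.rep 2 = 0)
    {m : Set (PG2 F)} (hm : IsTangentLine {P : PG2 F | G P.rep 0 ^ 2 + γ * G P.rep 1 ^ 2 +
      β * (G P.rep 1 * G P.rep 2) + α * G P.rep 2 ^ 2 = 0} m) : N ∈ m := by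
  have two : (2 : F) = 0 := CharTwo.two_eq_zero
  obtain ⟨⟨h, -, rfl⟩, hcard⟩ := hm
  by_contra hN
  obtain ⟨s, hs⟩ : ∃ s : Fin 3 → F, ∀ v, h v = s 0 * G v 0 + s 1 * G v 1 + s 2 * G v 2 := by
    refine ⟨fun i => h (G.symm fun j => if i = j then 1 else 0), fun v => ?_⟩
    conv_lhs => rw [← G.symm_apply_apply v, ← LinearEquiv.coe_coe, ← LinearMap.comp_apply,
      LinearMap.pi_apply_eq_sum_univ (h ∘ₗ G.symm.toLinearMap) (G v)]
    simp [Fin.sum_univ_three, mul_comm]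
  have hs0 : s 0 ≠ 0 := by
    intro h0
    exact hN (by simp [hs, h0, hN₁, hN₂])
  obtain ⟨P, hP⟩ := Set.ncard_eq_one.1 hcard
  obtain ⟨hPC, hPm⟩ : P ∈ _ ∩ _ := hP.symm ▸ Set.mem_singleton P
  simp only [Set.mem_ofPred_eq] at hPC hPm
  set p := G P.rep with hp
  rw [hs, ← hp] at hPm
  have hp0 : p 0 = (s 1 * p 1 + s 2 * p 2) / s 0 := by
    rw [eq_div_iff hs0]
    linear_combination hPm - (s 1 * p 1 + s 2 * p 2) * two
  have hpne : p 1 ≠ 0 ∨ p 2 ≠ 0 := by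
    by_contra! hp'
    refine P.rep_nonzero (G.injective ?_)
    rw [map_zero]
    funext i
    fin_cases i
    · simpa [hp'.1, hp'.2] using hp0
    · exact hp'.1
    · exact hp'.2
  have hred : ∀ a b : F, ((s 1 * a + s 2 * b) / s 0) ^ 2 + γ * a ^ 2 + β * (a * b) + α * b ^ 2 =
      (γ + (s 1 / s 0) ^ 2) * a ^ 2 + β * (a * b) + (α + (s 2 / s 0) ^ 2) * b ^ 2 := fun a b => by
    field_simp
    linear_combination s 1 * s 2 * a * b * two
  rw [hp0, hred] at hPC
  obtain ⟨a, b, hab, hzero⟩ := exists_second_zero hβ hpne hPC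
  rw [← hred] at hzero
  set c := (s 1 * a + s 2 * b) / s 0
  have hc : s 0 * c = s 1 * a + s 2 * b := mul_div_cancel₀ _ hs0
  have hv : G.symm ![c, a, b] ≠ 0 := by
    intro h0
    have h0' : ![c, a, b] = 0 := G.symm.injective (by rw [h0, map_zero])
    have ha : a = 0 := congrFun h0' 1
    have hb : b = 0 := congrFun h0' 2
    simp [ha, hb] at hab
  obtain ⟨t, ht, hrep⟩ := exists_rep_mk_eq_smul hv
  have hG : G (Projectivization.mk F _ hv).rep = t • ![c, a, b] := by
    rw [hrep, map_smul, LinearEquiv.apply_symm_apply]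
  have hmem : Projectivization.mk F _ hv ∈ ({P} : Set (PG2 F)) := by
    rw [← hP]
    constructor
    · simp only [Set.mem_ofPred_eq, hG]
      simp
      linear_combination t ^ 2 * hzero
    · simp only [Set.mem_ofPred_eq, hs, hG]
      simp
      linear_combination t * hc + t * (s 1 * a + s 2 * b) * two
  rw [Set.mem_singleton_iff] at hmem
  rw [hp, ← hmem, hG] at hab
  simp at hab
  exact hab (by ring)

end Conics

section Coordinates

lemma linearForm_ne_zero (G : (Fin 3 → F) ≃ₗ[F] (Fin 3 → F)) {h : (Fin 3 → F) →ₗ[F] F}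
    {v : Fin 3 → F} (hv : h (G.symm v) ≠ 0) : h ≠ 0 := by
  rintro rfl
  exact hv rfl

lemma symm_apply_ne_zero (G : (Fin 3 → F) ≃ₗ[F] (Fin 3 → F)) {v : Fin 3 → F} (hv : v ≠ 0) :
    G.symm v ≠ 0 := by
  simpa using hv

/-- The linear automorphism with the coordinates `![u, v, w]`, provided these have no common
zero. -/
noncomputable def coordinates (u v w : (Fin 3 → F) →ₗ[F] F)
    (h : ∀ x, u x = 0 → v x = 0 → w x = 0 → x = 0) : (Fin 3 → F) ≃ₗ[F] (Fin 3 → F) :=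
  LinearEquiv.ofInjectiveEndo (LinearMap.pi ![u, v, w]) <| by
    rw [← LinearMap.ker_eq_bot, LinearMap.ker_eq_bot']
    intro x hx
    exact h x (congrFun hx 0) (congrFun hx 1) (congrFun hx 2)

lemma coordinates_apply (u v w : (Fin 3 → F) →ₗ[F] F)
    (h : ∀ x, u x = 0 → v x = 0 → w x = 0 → x = 0) (x : Fin 3 → F) :
    coordinates u v w h x = ![u x, v x, w x] := by
  funext i
  fin_cases i <;> rfl

lemma exists_coordinates {f : (Fin 3 → F) →ₗ[F] F} (hf : f ≠ 0) :
    ∃ G : (Fin 3 → F) ≃ₗ[F] (Fin 3 → F), ∀ v, G v 0 = f v := by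
  obtain ⟨a, ha⟩ : ∃ a : Fin 3 → F, ∀ v, f v = v 0 * a 0 + v 1 * a 1 + v 2 * a 2 :=
    ⟨fun i => f fun j => if i = j then 1 else 0, fun v => by
      rw [LinearMap.pi_apply_eq_sum_univ f v, Fin.sum_univ_three]; rfl⟩
  have hex : a 0 ≠ 0 ∨ a 1 ≠ 0 ∨ a 2 ≠ 0 := by
    by_contra! h
    exact hf (LinearMap.ext fun v => by simp [ha, h])
  have hext : ∀ x : Fin 3 → F, x 0 = 0 → x 1 = 0 → x 2 = 0 → x = 0 := by
    intro x h0 h1 h2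
    funext i
    fin_cases i
    exacts [h0, h1, h2]
  rcases hex with h | h | h
  · refine ⟨coordinates f (.proj 1) (.proj 2) fun x h0 h1 h2 => ?_, fun v => rfl⟩
    simp only [LinearMap.proj_apply] at h1 h2
    simp only [ha, h1, h2, zero_mul, add_zero, mul_eq_zero, h, or_false] at h0
    exact hext x h0 h1 h2
  · refine ⟨coordinates f (.proj 0) (.proj 2) fun x h0 h1 h2 => ?_, fun v => rfl⟩
    simp only [LinearMap.proj_apply] at h1 h2
    simp only [ha, h1, h2, zero_mul, add_zero, zero_add, mul_eq_zero, h, or_false] at h0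
    exact hext x h1 h0 h2
  · refine ⟨coordinates f (.proj 0) (.proj 1) fun x h0 h1 h2 => ?_, fun v => rfl⟩
    simp only [LinearMap.proj_apply] at h1 h2
    simp only [ha, h1, h2, zero_mul, zero_add, mul_eq_zero, h, or_false] at h0
    exact hext x h1 h2 h0

lemma mk_symm_injective (G : (Fin 3 → F) ≃ₗ[F] (Fin 3 → F)) (hne : ∀ t, G.symm ![0, 1, t] ≠ 0) :
    Function.Injective fun t => Projectivization.mk F (G.symm ![0, 1, t]) (hne t) := by
  intro t t' h
  obtain ⟨c, hc⟩ := (Projectivization.mk_eq_mk_iff' F _ _ _ _).1 h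
  rw [← map_smul, G.symm.injective.eq_iff] at hc
  have h1 : c * 1 = 1 := congrFun hc 1
  have h2 : c * t' = t := congrFun hc 2
  rw [mul_one] at h1
  rw [← h2, h1, one_mul]

lemma symm_line_point_ne_zero (G : (Fin 3 → F) ≃ₗ[F] (Fin 3 → F)) (t : F) :
    G.symm ![0, 1, t] ≠ 0 :=
  symm_apply_ne_zero G (mk3_ne_zero (.inr (.inl one_ne_zero)))

lemma symm_infinity_ne_zero (G : (Fin 3 → F) ≃ₗ[F] (Fin 3 → F)) : G.symm ![0, 0, 1] ≠ 0 :=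
  symm_apply_ne_zero G (mk3_ne_zero (.inr (.inr one_ne_zero)))

/-- Coordinates in which a given line is `X₀ = 0` and a small set avoids `(0 : 0 : 1)`. -/
lemma exists_coordinates_avoiding [Fintype F] {f : (Fin 3 → F) →ₗ[F] F} (hf : f ≠ 0)
    {S : Set (PG2 F)} (hS : S.ncard < Fintype.card F) :
    ∃ G : (Fin 3 → F) ≃ₗ[F] (Fin 3 → F), (∀ v, G v 0 = f v) ∧
      Projectivization.mk F _ (symm_infinity_ne_zero G) ∉ S := by
  obtain ⟨G, hG⟩ := exists_coordinates hf
  obtain ⟨t, ht⟩ : ∃ t, Projectivization.mk F _ (symm_line_point_ne_zero G t) ∉ S := by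
    by_contra! h
    have h1 := Set.ncard_le_ncard (Set.range_subset_iff.2 h) (Set.toFinite S)
    rw [← Set.image_univ, Set.ncard_image_of_injective _ (mk_symm_injective G _),
      Set.ncard_univ, Nat.card_eq_fintype_card] at h1
    omega
  let g : Fin 3 → (Fin 3 → F) →ₗ[F] F := fun i => .proj i ∘ₗ G.toLinearMap
  have hg : ∀ i v, g i v = G v i := fun _ _ => rfl
  let H := coordinates f (g 2 - t • g 1) (g 1) fun x h0 h1 h2 => by
    simp only [LinearMap.sub_apply, LinearMap.smul_apply, h2, smul_zero, sub_zero] at h1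
    rw [← hG] at h0
    refine G.injective ?_
    rw [map_zero]
    funext i
    fin_cases i
    exacts [h0, h2, h1]
  have hH : ∀ v, H v = ![f v, G v 2 - t * G v 1, G v 1] := coordinates_apply _ _ _ _
  refine ⟨H, fun v => by rw [hH]; rfl, ?_⟩
  have hsymm : H.symm ![0, 0, 1] = G.symm ![0, 1, t] := by
    rw [LinearEquiv.symm_apply_eq, hH]
    simp [← hG]
  simpa only [hsymm] using ht

end Coordinates

section Focus

variable {K l : Set (PG2 F)}

lemma mem_focusSet [Finite F] {P Q : PG2 F} (hP : P ∈ K) (hQ : Q ∈ K) (hPQ : P ≠ Q)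
    {h : (Fin 3 → F) →ₗ[F] F} (hh : h ≠ 0) (hhP : h P.rep = 0) (hhQ : h Q.rep = 0)
    {R : PG2 F} (hR : R ∈ l) (hhR : h R.rep = 0) : R ∈ FocusSet K l := by
  refine ⟨hR, {P | h P.rep = 0}, ⟨⟨h, hh, rfl⟩, ?_⟩, hhR⟩
  rw [← Set.ncard_pair hPQ]
  refine Set.ncard_le_ncard ?_ (Set.toFinite _)
  rintro T (rfl | rfl)
  exacts [⟨hP, hhP⟩, ⟨hQ, hhQ⟩]

lemma IsArc.eq_of_apply_eq_zero [Finite F] (hK : IsArc K) {P Q R : PG2 F} (hP : P ∈ K) (hQ : Q ∈ K)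
    (hR : R ∈ K) (hPQ : P ≠ Q) (hPR : P ≠ R) {h : (Fin 3 → F) →ₗ[F] F} (hh : h ≠ 0)
    (hhP : h P.rep = 0) (hhQ : h Q.rep = 0) (hhR : h R.rep = 0) : Q = R := by
  by_contra hQR
  have h3 : ({P, Q, R} : Set (PG2 F)).ncard = 3 :=
    Set.ncard_eq_three.2 ⟨P, Q, R, hPQ, hPR, hQR, rfl⟩
  have h2 := hK _ ⟨h, hh, rfl⟩
  have : ({P, Q, R} : Set (PG2 F)).ncard ≤ (K ∩ {P | h P.rep = 0}).ncard := by
    refine Set.ncard_le_ncard ?_ (Set.toFinite _)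
    rintro T (rfl | rfl | rfl)
    exacts [⟨hP, hhP⟩, ⟨hQ, hhQ⟩, ⟨hR, hhR⟩]
  omega

end Focus

/-- every hyperfocused 12-arc in `PG(2,32)` is contained in a
hyperconic, i.e. in the union of a conic and its nucleus (the common point of
all tangent lines to the conic). -/
theorem hyperfocused_twelve_arc_in_hyperconic {F : Type*} [Field F] [Fintype F]
    (hF : Fintype.card F = 32)
    (K l : Set (PG2 F)) (harc : IsArc K) (hcard : K.ncard = 12)
    (hhf : Hyperfocused K l) :
    ∃ (C : Set (PG2 F)) (N : PG2 F), IsConic C ∧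
      (∀ m : Set (PG2 F), IsTangentLine C m → N ∈ m) ∧
      K ⊆ C ∪ {N} := by
  classical
  have := charP_two_of_card_eq hF
  obtain ⟨⟨f, hf, rfl⟩, hdisj, hfocus⟩ := hhf
  rw [hcard] at hfocus
  obtain ⟨G, hG, hinf⟩ := exists_coordinates_avoiding hf (S := FocusSet K {P | f P.rep = 0})
    (by rw [hfocus, hF]; norm_num)
  obtain ⟨p, hpinj, rfl⟩ : ∃ p : Fin 12 → PG2 F, Function.Injective p ∧ Set.range p = K := by
    have e : Fin 12 ≃ K := (Finite.equivFinOfCardEq (by rw [Nat.card_coe_set_eq, hcard])).symm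
    exact ⟨fun i => e i, Subtype.val_injective.comp e.injective, by
      rw [← Function.comp_def, Set.range_comp, e.range_eq_univ, Set.image_univ, Subtype.range_val]⟩
  have hp : ∀ i, p i ∈ Set.range p := Set.mem_range_self
  have hne : ∀ i, G (p i).rep 0 ≠ 0 := fun i h =>
    Set.eq_empty_iff_forall_notMem.1 hdisj (p i) ⟨hp i, (hG _).symm.trans h⟩
  let X i := G (p i).rep 1 / G (p i).rep 0
  let Y i := G (p i).rep 2 / G (p i).rep 0
  have hX : ∀ i, G (p i).rep 1 = X i * G (p i).rep 0 := fun i => (div_mul_cancel₀ _ (hne i)).symm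
  have hY : ∀ i, G (p i).rep 2 = Y i * G (p i).rep 0 := fun i => (div_mul_cancel₀ _ (hne i)).symm
  let g : Fin 3 → (Fin 3 → F) →ₗ[F] F := fun i => .proj i ∘ₗ G.toLinearMap
  have hg : ∀ i v, g i v = G v i := fun _ _ => rfl
  have hXinj : Function.Injective X := by
    intro i j hij
    by_contra hne'
    let h := g 1 - X i • g 0
    have hh : ∀ v, h v = G v 1 - X i * G v 0 := fun _ => rfl
    refine hinf (mem_focusSet (hp i) (hp j) (hpinj.ne hne') (h := h)
      (linearForm_ne_zero G (v := ![0, 1, 0]) (by simp [hh])) ?_ ?_ ?_ ?_)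
    · rw [hh, hX, sub_self]
    · rw [hh, hX, hij, sub_self]
    · exact (apply_rep_mk_eq_zero_iff f _).2 (by simp [← hG])
    · exact (apply_rep_mk_eq_zero_iff h _).2 (by simp [hh])
  let chord (i : Fin 12) (d : F) := g 2 - d • g 1 - (Y i - d * X i) • g 0
  have hchord : ∀ i d v, chord i d v = G v 2 - d * G v 1 - (Y i - d * X i) * G v 0 :=
    fun _ _ _ => rfl
  have hchord_ne : ∀ i d, chord i d ≠ 0 := fun i d =>
    linearForm_ne_zero G (v := ![0, 0, 1]) (by simp [hchord])
  have hchord_self : ∀ i d, chord i d (p i).rep = 0 := fun i d => by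
    rw [hchord, hX, hY]
    ring
  have hchord_slope : ∀ i j, i ≠ j → chord i ((Y i - Y j) / (X i - X j)) (p j).rep = 0 := by
    intro i j hij
    have hsub : X i - X j ≠ 0 := sub_ne_zero.2 (hXinj.ne hij)
    rw [hchord, hX, hY]
    field_simp
    ring
  let D : Finset F := Finset.univ.filter fun d =>
    Projectivization.mk F _ (symm_line_point_ne_zero G d) ∈ FocusSet (Set.range p) {P | f P.rep = 0}
  have hD : D.card ≤ 11 := by
    rw [← Set.ncard_coe_finset, ← Set.ncard_image_of_injective _ (mk_symm_injective G
      (symm_line_point_ne_zero G))]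
    refine (Set.ncard_le_ncard ?_ (Set.toFinite _)).trans hfocus.le
    rintro _ ⟨d, hd, rfl⟩
    exact (Finset.mem_filter.1 hd).2
  obtain ⟨α, β, γ, n, hβ, hrel⟩ := exists_quadratic_relation_of_slopes hF hXinj (D := D) (Y := Y)
    (fun i j hij => Finset.mem_filter.2 ⟨Finset.mem_univ _, mem_focusSet (hp i) (hp j)
      (hpinj.ne hij) (hchord_ne i _) (hchord_self i _) (hchord_slope i j hij)
      ((apply_rep_mk_eq_zero_iff f _).2 (by simp [← hG]))
      ((apply_rep_mk_eq_zero_iff _ _).2 (by simp [hchord]))⟩)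
    (fun i j k hij hik h => hpinj (harc.eq_of_apply_eq_zero (hp i) (hp j) (hp k) (hpinj.ne hij)
      (hpinj.ne hik) (hchord_ne i _) (hchord_self i _) (hchord_slope i j hij)
      (h ▸ hchord_slope i k hik))) hD
  let H := coordinates (g 0) (g 1 - X n • g 0) (g 2 - Y n • g 0) fun x h0 h1 h2 => by
    simp only [LinearMap.sub_apply, LinearMap.smul_apply, h0, smul_zero, sub_zero] at h1 h2
    refine G.injective ?_
    rw [map_zero]
    funext i
    fin_cases i
    exacts [h0, h1, h2]
  have hH₀ : ∀ v, H v 0 = G v 0 := fun _ => rfl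
  have hH₁ : ∀ v, H v 1 = G v 1 - X n * G v 0 := fun _ => rfl
  have hH₂ : ∀ v, H v 2 = G v 2 - Y n * G v 0 := fun _ => rfl
  refine ⟨_, p n, isConic_of_coordinates (α / β ^ 2) (γ / β ^ 2) (inv_ne_zero hβ) H, fun m hm =>
    mem_of_isTangentLine (inv_ne_zero hβ) H (by rw [hH₁, hX, sub_self]) (by rw [hH₂, hY, sub_self])
      hm, ?_⟩
  rintro _ ⟨k, rfl⟩
  obtain rfl | hk := eq_or_ne k n
  · exact .inr rfl
  · left
    rw [Set.mem_ofPred_eq, hH₀, hH₁, hH₂, hX, hY]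
    have two : (2 : F) = 0 := CharTwo.two_eq_zero
    field_simp
    linear_combination G (p k).rep 0 ^ 2 * hrel k hk + G (p k).rep 0 ^ 2 * β ^ 2 * two
end

section
/- Let K be a hyperfocused 12-arc in PG(2,32) on a line l, and let K0 ⊆ K be an 8-arc contained in K. Then the focus set of K0 on l (the set of points of l lying on some secant of K0) has size at least 8. -/
open scoped LinearAlgebra.Projectivization

variable {F : Type*} [Field F]

theorem IsLine.exists_mem_inter {l m : Set (PG2 F)} (hl : IsLine l) (hm : IsLine m) :
    (l ∩ m).Nonempty := by
  obtain ⟨f, -, rfl⟩ := hl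
  obtain ⟨g, -, rfl⟩ := hm
  have hker : LinearMap.ker (f.prod g) ≠ ⊥ := LinearMap.ker_ne_bot_of_finrank_lt (by simp)
  obtain ⟨v, hv, hv0⟩ := (Submodule.ne_bot_iff _).1 hker
  obtain ⟨hf, hg⟩ : f v = 0 ∧ g v = 0 := by simpa using hv
  obtain ⟨a, ha⟩ := Projectivization.exists_smul_eq_mk_rep F v hv0
  refine ⟨Projectivization.mk F v hv0, ?_, ?_⟩
  · simp [← ha, Units.smul_def, hf]
  · simp [← ha, Units.smul_def, hg]

theorem exists_isLine_through (A B : PG2 F) : ∃ m, IsLine m ∧ A ∈ m ∧ B ∈ m := by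
  let ev : ((Fin 3 → F) →ₗ[F] F) →ₗ[F] F × F :=
    (LinearMap.applyₗ A.rep).prod (LinearMap.applyₗ B.rep)
  have hker : LinearMap.ker ev ≠ ⊥ :=
    LinearMap.ker_ne_bot_of_finrank_lt (by simp)
  obtain ⟨f, hf, hf0⟩ := (Submodule.ne_bot_iff _).1 hker
  obtain ⟨hA, hB⟩ : f A.rep = 0 ∧ f B.rep = 0 := by simpa [ev] using hf
  exact ⟨_, ⟨f, hf0, rfl⟩, hA, hB⟩

theorem ker_eq_span_pair {f : (Fin 3 → F) →ₗ[F] F} (hf : f ≠ 0) {A B : PG2 F} (hAB : A ≠ B)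
    (hA : f A.rep = 0) (hB : f B.rep = 0) :
    LinearMap.ker f = Submodule.span F {A.rep, B.rep} := by
  symm
  apply Submodule.eq_of_le_of_finrank_eq
  · rw [Submodule.span_le]
    rintro v (rfl | rfl)
    · exact hA
    · exact hB
  · have hind : LinearIndependent F ![A.rep, B.rep] := by
      have h := Projectivization.independent_iff.1
        ((Projectivization.independent_pair_iff_ne A B).2 hAB)
      have hcomp : Projectivization.rep ∘ ![A, B] = ![A.rep, B.rep] := by
        ext i : 1
        fin_cases i <;> rfl
      rwa [hcomp] at h
    have hspan := finrank_span_eq_card hind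
    rw [Matrix.range_cons_cons_empty] at hspan
    have hker := Module.Dual.finrank_ker_add_one_of_ne_zero hf
    simp only [Module.finrank_fin_fun, Fintype.card_fin] at hker hspan
    omega

theorem IsLine.eq_of_mem {m m' : Set (PG2 F)} (hm : IsLine m) (hm' : IsLine m') {A B : PG2 F}
    (hAB : A ≠ B) (hA : A ∈ m) (hB : B ∈ m) (hA' : A ∈ m') (hB' : B ∈ m') : m = m' := by
  obtain ⟨f, hf, rfl⟩ := hm
  obtain ⟨g, hg, rfl⟩ := hm'
  have hker := (ker_eq_span_pair hf hAB hA hB).trans (ker_eq_span_pair hg hAB hA' hB').symm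
  ext P
  exact SetLike.ext_iff.1 hker P.rep

/-- On a line, the pairs of points joined to a point `X` outside an arc form a matching. -/
theorem IsArc.eq_of_collinear3 [Finite F] {K : Set (PG2 F)} (hK : IsArc K) {A B C X : PG2 F}
    (hA : A ∈ K) (hB : B ∈ K) (hC : C ∈ K) (hX : X ∉ K) (hAB : A ≠ B) (hAC : A ≠ C)
    (hABX : Collinear3 A B X) (hACX : Collinear3 A C X) : B = C := by
  obtain ⟨m, hm, hAm, hBm, hXm⟩ := hABX
  obtain ⟨m', hm', hAm', hCm', hXm'⟩ := hACX
  have hAX : A ≠ X := fun h => hX (h ▸ hA)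
  obtain rfl := hm.eq_of_mem hm' hAX hAm hXm hAm' hXm'
  by_contra hBC
  have hsub : ({A, B, C} : Set (PG2 F)) ⊆ K ∩ m := by
    rintro P (rfl | rfl | rfl)
    exacts [⟨hA, hAm⟩, ⟨hB, hBm⟩, ⟨hC, hCm'⟩]
  have hle := Set.ncard_le_ncard hsub (Set.toFinite _)
  rw [Set.ncard_eq_three.2 ⟨A, B, C, hAB, hAC, hBC, rfl⟩] at hle
  have := hK m hm
  omega

theorem IsLine.exists_collinear3 {l : Set (PG2 F)} (hl : IsLine l) (A B : PG2 F) :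
    ∃ X ∈ l, Collinear3 A B X := by
  obtain ⟨m, hm, hA, hB⟩ := exists_isLine_through A B
  obtain ⟨X, hXl, hXm⟩ := hl.exists_mem_inter hm
  exact ⟨X, hXl, m, hm, hA, hB, hXm⟩

theorem mem_focusSet_of_collinear3 [Finite F] {K l : Set (PG2 F)} {A B X : PG2 F}
    (hA : A ∈ K) (hB : B ∈ K) (hAB : A ≠ B) (hX : X ∈ l) (h : Collinear3 A B X) :
    X ∈ FocusSet K l := by
  obtain ⟨m, hm, hAm, hBm, hXm⟩ := h
  refine ⟨hX, m, ⟨hm, ?_⟩, hXm⟩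
  exact (Set.one_lt_ncard (Set.toFinite _)).2 ⟨A, ⟨hA, hAm⟩, B, ⟨hB, hBm⟩, hAB⟩

theorem FocusSet.mono [Finite F] {K₀ K l : Set (PG2 F)} (h : K₀ ⊆ K) :
    FocusSet K₀ l ⊆ FocusSet K l := by
  rintro X ⟨hX, m, ⟨hm, hcard⟩, hXm⟩
  exact ⟨hX, m, ⟨hm, hcard.trans
    (Set.ncard_le_ncard (Set.inter_subset_inter_left m h) (Set.toFinite _))⟩, hXm⟩

/-- A proper subarc `K₀` with fewer than `|K₀|` foci forces at least `2|K₀| - 1` foci of `K`: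
the secants joining `K₀` to a further point of `K` miss the foci of `K₀`. -/
theorem IsArc.two_mul_ncard_le_focusSet [Finite F] {K K₀ l : Set (PG2 F)} (hK : IsArc K)
    (hl : IsLine l) (hKl : K ∩ l = ∅) (hss : K₀ ⊂ K) (hne : K₀.Nonempty)
    (hfoc : (FocusSet K₀ l).ncard < K₀.ncard) :
    2 * K₀.ncard ≤ (FocusSet K l).ncard + 1 := by
  choose c hcl hc using hl.exists_collinear3
  have hout (A B) : c A B ∉ K := fun h =>
    Set.disjoint_left.1 (Set.disjoint_iff_inter_eq_empty.2 hKl) h (hcl A B)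
  have hinj {A B C} (hA : A ∈ K) (hB : B ∈ K) (hC : C ∈ K) (hAB : A ≠ B) (hAC : A ≠ C)
      (h : c A B = c A C) : B = C :=
    hK.eq_of_collinear3 hA hB hC (hout A B) hAB hAC (hc A B) (h ▸ hc A C)
  have himage {P} (hP : P ∈ K₀) : (c P '' (K₀ \ {P})).ncard = K₀.ncard - 1 := by
    rw [Set.InjOn.ncard_image, Set.ncard_sdiff_singleton_of_mem hP]
    intro A hA B hB
    exact hinj (hss.1 hP) (hss.1 hA.1) (hss.1 hB.1) (Ne.symm hA.2) (Ne.symm hB.2)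
  have hsub {P} (hP : P ∈ K₀) : c P '' (K₀ \ {P}) ⊆ FocusSet K₀ l := by
    rintro _ ⟨A, hA, rfl⟩
    exact mem_focusSet_of_collinear3 hP hA.1 (Ne.symm hA.2) (hcl P A) (hc P A)
  have heq {P} (hP : P ∈ K₀) : c P '' (K₀ \ {P}) = FocusSet K₀ l :=
    Set.eq_of_subset_of_ncard_le (hsub hP) (by rw [himage hP]; omega) (Set.toFinite _)
  obtain ⟨Q, hQ, hQ₀⟩ := Set.exists_of_ssubset hss
  have hQne {P} (hP : P ∈ K₀) : Q ≠ P := fun h => hQ₀ (h ▸ hP)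
  have hcard : (c Q '' K₀).ncard = K₀.ncard := Set.InjOn.ncard_image fun A hA B hB =>
    hinj hQ (hss.1 hA) (hss.1 hB) (hQne hA) (hQne hB)
  have hdisj : Disjoint (c Q '' K₀) (FocusSet K₀ l) := by
    rw [Set.disjoint_left]
    rintro _ ⟨P, hP, rfl⟩ hfocus
    rw [← heq hP] at hfocus
    obtain ⟨A, hA, hAQ⟩ := hfocus
    obtain ⟨m, hm, hQm, hPm, hXm⟩ := hc Q P
    exact hQ₀ (hK.eq_of_collinear3 (hss.1 hP) hQ (hss.1 hA.1) (hout Q P) (hQne hP).symm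
      (Ne.symm hA.2) ⟨m, hm, hPm, hQm, hXm⟩ (hAQ ▸ hc P A) ▸ hA.1)
  have hunion : c Q '' K₀ ∪ FocusSet K₀ l ⊆ FocusSet K l := by
    apply Set.union_subset _ (FocusSet.mono hss.1)
    rintro _ ⟨P, hP, rfl⟩
    exact mem_focusSet_of_collinear3 hQ (hss.1 hP) (hQne hP) (hcl Q P) (hc Q P)
  have htotal := Set.ncard_le_ncard hunion (Set.toFinite _)
  rw [Set.ncard_union_eq hdisj (Set.toFinite _) (Set.toFinite _), hcard] at htotal
  obtain ⟨P, hP⟩ := hne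
  have hlow := Set.ncard_le_ncard (hsub hP) (Set.toFinite _)
  rw [himage hP] at hlow
  omega


/-- if `K` is a hyperfocused 12-arc in `PG(2,32)` on the line `l`
and `K0 ⊆ K` is an 8-arc, then the focus set of `K0` on `l` has size at
least 8. -/
theorem focusSet_of_eight_subarc_ge_eight {F : Type*} [Field F] [Fintype F]
    (hF : Fintype.card F = 32)
    (K l : Set (PG2 F)) (harc : IsArc K) (hcard : K.ncard = 12)
    (hhf : Hyperfocused K l)
    (K0 : Set (PG2 F)) (hK0 : K0 ⊆ K) (harc0 : IsArc K0) (hcard0 : K0.ncard = 8) :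
    8 ≤ (FocusSet K0 l).ncard := by
  obtain ⟨hl, hKl, hfoc⟩ := hhf
  by_contra! hlt
  have hne : K0.Nonempty := Set.nonempty_of_ncard_ne_zero (by omega)
  have hss : K0 ⊂ K := hK0.ssubset_of_ne (by rintro rfl; omega)
  have := harc.two_mul_ncard_le_focusSet hl hKl hss hne (by omega)
  omega
end

section
/- In PG(2,q) with q even, every k-arc that is sharply focused on a line l is contained in a (k+1)-arc that is hyperfocused on l. -/
open scoped LinearAlgebra.Projectivization

variable {F : Type*} [Field F]

/-- The linear form whose value at `R.rep` is the determinant of the representatives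
of `P`, `Q` and `R`. -/
noncomputable def triForm (P Q : PG2 F) : (Fin 3 → F) →ₗ[F] F :=
  (P.rep 1 * Q.rep 2 - P.rep 2 * Q.rep 1) • LinearMap.proj 0 +
  (P.rep 2 * Q.rep 0 - P.rep 0 * Q.rep 2) • LinearMap.proj 1 +
  (P.rep 0 * Q.rep 1 - P.rep 1 * Q.rep 0) • LinearMap.proj 2

/-- The determinant of the representatives of three points. -/
noncomputable def tri (P Q R : PG2 F) : F := triForm P Q R.rep

lemma tri_eq (P Q R : PG2 F) : tri P Q R =
    (P.rep 1 * Q.rep 2 - P.rep 2 * Q.rep 1) * R.rep 0 +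
    (P.rep 2 * Q.rep 0 - P.rep 0 * Q.rep 2) * R.rep 1 +
    (P.rep 0 * Q.rep 1 - P.rep 1 * Q.rep 0) * R.rep 2 := by
  simp [tri, triForm]

lemma tri_rotate (P Q R : PG2 F) : tri P Q R = tri Q R P := by
  simp only [tri_eq]; ring

lemma tri_swap (P Q R : PG2 F) : tri P Q R = -tri Q P R := by
  simp only [tri_eq]; ring

lemma tri_swap_right (P Q R : PG2 F) : tri P Q R = -tri P R Q := by
  simp only [tri_eq]; ring

lemma tri_self_left (P Q : PG2 F) : tri P Q P = 0 := by
  simp only [tri_eq]; ring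

lemma tri_self_right (P Q : PG2 F) : tri P Q Q = 0 := by
  simp only [tri_eq]; ring

lemma tri_plucker (A B C P Q : PG2 F) :
    tri A B P * tri C A Q - tri A B Q * tri C A P = - (tri A B C * tri A P Q) := by
  simp only [tri_eq]; ring

lemma form_apply_three (f : (Fin 3 → F) →ₗ[F] F) (v : Fin 3 → F) :
    f v = f (Pi.single 0 1) * v 0 + f (Pi.single 1 1) * v 1 + f (Pi.single 2 1) * v 2 := by
  have hv : v = v 0 • Pi.single 0 1 + v 1 • Pi.single 1 1 + v 2 • Pi.single 2 1 := by
    ext i; fin_cases i <;> simp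
  conv_lhs => rw [hv]
  simp only [map_add, map_smul, smul_eq_mul, mul_comm]

lemma form_barycentric (f : (Fin 3 → F) →ₗ[F] F) (A B C P : PG2 F) :
    tri A B C * f P.rep =
      f A.rep * tri B C P + f B.rep * tri C A P + f C.rep * tri A B P := by
  simp only [tri_eq, form_apply_three f P.rep, form_apply_three f A.rep,
    form_apply_three f B.rep, form_apply_three f C.rep]
  ring

lemma eq_of_triForm_eq_zero {P Q : PG2 F} (h : triForm P Q = 0) : P = Q := by
  have h0 := LinearMap.congr_fun h (Pi.single 0 1)
  have h1 := LinearMap.congr_fun h (Pi.single 1 1)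
  have h2 := LinearMap.congr_fun h (Pi.single 2 1)
  simp [triForm] at h0 h1 h2
  have key : ∀ i j, P.rep i * Q.rep j = P.rep j * Q.rep i := by
    intro i j
    fin_cases i <;> fin_cases j <;> simp <;> grind
  obtain ⟨i, hi⟩ := Function.ne_iff.mp P.rep_nonzero
  rw [← P.mk_rep, ← Q.mk_rep, eq_comm, Projectivization.mk_eq_mk_iff']
  refine ⟨Q.rep i / P.rep i, ?_⟩
  ext j
  have := key i j
  simp at hi ⊢
  field_simp
  linear_combination -this

lemma isLine_tri {P Q : PG2 F} (h : P ≠ Q) : IsLine {R : PG2 F | tri P Q R = 0} :=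
  ⟨triForm P Q, fun h0 => h (eq_of_triForm_eq_zero h0), rfl⟩

lemma IsLine.mem_iff_tri {m : Set (PG2 F)} (hm : IsLine m) {P Q : PG2 F} (h : P ≠ Q)
    (hP : P ∈ m) (hQ : Q ∈ m) (R : PG2 F) : R ∈ m ↔ tri P Q R = 0 := by
  obtain ⟨f, hf, rfl⟩ := hm
  simp only [Set.mem_ofPred_eq] at *
  constructor
  · intro hR
    by_contra ht
    apply hf
    have e (v : Fin 3 → F) : tri P Q R * f v = 0 := by
      rw [form_apply_three] at hP hQ hR ⊢
      rw [tri_eq]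
      linear_combination
        ((Q.rep 1 * R.rep 2 - Q.rep 2 * R.rep 1) * v 0 +
          (Q.rep 2 * R.rep 0 - Q.rep 0 * R.rep 2) * v 1 +
          (Q.rep 0 * R.rep 1 - Q.rep 1 * R.rep 0) * v 2) * hP +
        ((R.rep 1 * P.rep 2 - R.rep 2 * P.rep 1) * v 0 +
          (R.rep 2 * P.rep 0 - R.rep 0 * P.rep 2) * v 1 +
          (R.rep 0 * P.rep 1 - R.rep 1 * P.rep 0) * v 2) * hQ +
        ((P.rep 1 * Q.rep 2 - P.rep 2 * Q.rep 1) * v 0 +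
          (P.rep 2 * Q.rep 0 - P.rep 0 * Q.rep 2) * v 1 +
          (P.rep 0 * Q.rep 1 - P.rep 1 * Q.rep 0) * v 2) * hR
    ext1 i
    ext
    simpa [ht] using e (Pi.single i 1)
  · intro ht
    have e (v : Fin 3 → F) : triForm P Q v * f R.rep = 0 := by
      have : triForm P Q v * f R.rep = tri P Q R * f v := by
        rw [form_apply_three] at hP hQ
        rw [tri_eq, form_apply_three f, form_apply_three f v]
        simp only [triForm, LinearMap.add_apply, LinearMap.smul_apply, LinearMap.proj_apply,
          smul_eq_mul]
        linear_combination
          -((Q.rep 1 * R.rep 2 - Q.rep 2 * R.rep 1) * v 0 +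
            (Q.rep 2 * R.rep 0 - Q.rep 0 * R.rep 2) * v 1 +
            (Q.rep 0 * R.rep 1 - Q.rep 1 * R.rep 0) * v 2) * hP -
          ((R.rep 1 * P.rep 2 - R.rep 2 * P.rep 1) * v 0 +
            (R.rep 2 * P.rep 0 - R.rep 0 * P.rep 2) * v 1 +
            (R.rep 0 * P.rep 1 - R.rep 1 * P.rep 0) * v 2) * hQ
      rw [this, ht, zero_mul]
    by_contra hR
    refine h (eq_of_triForm_eq_zero (LinearMap.ext fun v => ?_))
    simpa [hR] using e v

lemma exists_common_zero (f g : (Fin 3 → F) →ₗ[F] F) :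
    ∃ X : PG2 F, f X.rep = 0 ∧ g X.rep = 0 := by
  have h : LinearMap.ker (f.prod g) ≠ ⊥ := LinearMap.ker_ne_bot_of_finrank_lt (by simp)
  obtain ⟨v, hv, hv0⟩ := Submodule.exists_mem_ne_zero_of_ne_bot h
  obtain ⟨a, ha⟩ := Projectivization.exists_smul_eq_mk_rep F v hv0
  simp only [LinearMap.mem_ker, LinearMap.prod_apply, Function.prod_apply, Prod.mk_eq_zero] at hv
  refine ⟨Projectivization.mk F v hv0, ?_, ?_⟩ <;> rw [← ha, Units.smul_def, map_smul] <;>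
    simp [hv]

lemma tri_trans {P Q X Y : PG2 F} (h : P ≠ Q) (hX : tri P Q X = 0) (hY : tri P Q Y = 0) :
    tri P X Y = 0 := by
  by_cases e : P = X
  · subst e
    rw [tri_eq]; ring
  · exact ((isLine_tri h).mem_iff_tri e (tri_self_left P Q) hX Y).mp hY

lemma IsLine.eq_of_tri {l : Set (PG2 F)} (hl : IsLine l) {P X Y : PG2 F} (hP : P ∉ l)
    (hX : X ∈ l) (hY : Y ∈ l) (h : tri P X Y = 0) : X = Y := by
  by_contra hne
  exact hP ((hl.mem_iff_tri hne hX hY P).mpr (by rw [← tri_rotate, h]))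

lemma IsLine.exists_mem_tri {l : Set (PG2 F)} (hl : IsLine l) (P Q : PG2 F) :
    ∃ X ∈ l, tri P Q X = 0 := by
  obtain ⟨f, -, rfl⟩ := hl
  exact exists_common_zero f (triForm P Q)

lemma prod_eq_of_image_erase {α M : Type*} [DecidableEq α] [CommMonoid M] {K D : Finset α}
    {A B C t e : α} {φ : α → α} {g : α → M} (hinj : Set.InjOn φ (K.erase A))
    (himg : (K.erase A).image φ = D.erase t) (ht : t ∈ D) (he : e ∈ D)
    (hB : B ∈ K.erase A) (hC : C ∈ K.erase A) (heB : e ≠ φ B) (heC : e ≠ φ C)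
    (hg : ∀ P ∈ K \ {A, B, C}, g (φ P) = g P) :
    g t * ∏ P ∈ K \ {A, B, C}, g P = g e * ∏ d ∈ D \ {e, φ B, φ C}, g d := by
  have hφ : ∀ P ∈ K.erase A, φ P ≠ t ∧ φ P ∈ D := by
    intro P hP
    have := Finset.mem_image_of_mem φ hP
    rwa [himg, Finset.mem_erase] at this
  have h1 : ∏ P ∈ K \ {A, B, C}, g P = ∏ d ∈ D \ {t, φ B, φ C}, g d := by
    rw [← Finset.prod_congr rfl hg, ← Finset.prod_image (f := g) (g := φ)]
    · congr 1
      ext d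
      constructor
      · intro hd
        obtain ⟨P, hP, rfl⟩ := Finset.mem_image.mp hd
        simp only [Finset.mem_sdiff, Finset.mem_insert, Finset.mem_singleton, not_or] at hP ⊢
        have hP' : P ∈ K.erase A := Finset.mem_erase.mpr ⟨hP.2.1, hP.1⟩
        exact ⟨(hφ P hP').2, (hφ P hP').1, fun h => hP.2.2.1 (hinj hP' hB h),
          fun h => hP.2.2.2 (hinj hP' hC h)⟩
      · intro hd
        simp only [Finset.mem_sdiff, Finset.mem_insert, Finset.mem_singleton, not_or] at hd
        have : d ∈ (K.erase A).image φ := himg ▸ Finset.mem_erase.mpr ⟨hd.2.1, hd.1⟩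
        obtain ⟨P, hP, rfl⟩ := Finset.mem_image.mp this
        refine Finset.mem_image_of_mem φ ?_
        simp only [Finset.mem_sdiff, Finset.mem_insert, Finset.mem_singleton, not_or]
        exact ⟨Finset.mem_of_mem_erase hP, Finset.ne_of_mem_erase hP,
          fun h => hd.2.2.1 (h ▸ rfl), fun h => hd.2.2.2 (h ▸ rfl)⟩
    · refine hinj.mono fun P hP => ?_
      simp only [Finset.coe_sdiff, Set.mem_sdiff, Finset.mem_coe, Finset.mem_insert,
        Finset.mem_singleton, not_or] at hP
      simp [hP]
  have h2 : ∀ x ∈ D, x ≠ φ B → x ≠ φ C →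
      g x * ∏ d ∈ D \ {x, φ B, φ C}, g d = ∏ d ∈ D \ {φ B, φ C}, g d := by
    intro x hx hxB hxC
    rw [← Finset.mul_prod_erase (D \ {φ B, φ C}) g (a := x) (by simp [*]),
      Finset.erase_eq, sdiff_sdiff_left, Finset.insert_eq x, sup_comm]
    rfl
  rw [h1, h2 t ht (hφ B hB).1.symm (hφ C hC).1.symm, h2 e he heB heC]

/-- For `P` on neither `CA` nor `AB`, the ratio in which the line `AP` divides the side `BC`
of the triangle `ABC`, up to a factor depending on the representatives only. -/
noncomputable def cevaRatio (A B C P : PG2 F) : F := tri A B P / tri C A P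

lemma prod_cevaRatio_eq_one {A B C : PG2 F} {S : Finset (PG2 F)}
    (hS : ∀ P ∈ S, tri A B P ≠ 0 ∧ tri B C P ≠ 0 ∧ tri C A P ≠ 0) :
    (∏ P ∈ S, cevaRatio A B C P) * (∏ P ∈ S, cevaRatio B C A P) *
      ∏ P ∈ S, cevaRatio C A B P = 1 := by
  rw [← Finset.prod_mul_distrib, ← Finset.prod_mul_distrib]
  refine Finset.prod_eq_one fun P hP => ?_
  obtain ⟨h1, h2, h3⟩ := hS P hP
  unfold cevaRatio
  field_simp

/-- A finite arc `K` off the line `l`, with focus set `D`, such that every point `P` of `K` sees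
all points of `D` but `t P` along its secants; `φ P Q` is the point of `l` on the secant `PQ`. -/
structure FocusData [DecidableEq (PG2 F)] (l : Set (PG2 F)) (K D : Finset (PG2 F))
    (φ : PG2 F → PG2 F → PG2 F) (t : PG2 F → PG2 F) : Prop where
  isLine : IsLine l
  notMem : ∀ P ∈ K, P ∉ l
  tri_ne_zero : ∀ P ∈ K, ∀ Q ∈ K, ∀ R ∈ K, P ≠ Q → P ≠ R → Q ≠ R → tri P Q R ≠ 0
  focus_mem : ∀ P Q, φ P Q ∈ l
  tri_focus : ∀ P Q, tri P Q (φ P Q) = 0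
  mem_iff : ∀ X, X ∈ D ↔ X ∈ l ∧ ∃ P ∈ K, ∃ Q ∈ K, P ≠ Q ∧ tri P Q X = 0
  tangent_mem : ∀ P ∈ K, t P ∈ D
  image_focus : ∀ P ∈ K, (K.erase P).image (φ P) = D.erase (t P)

namespace FocusData

variable [DecidableEq (PG2 F)] {l : Set (PG2 F)} {K D : Finset (PG2 F)}
  {φ : PG2 F → PG2 F → PG2 F} {t : PG2 F → PG2 F} {A B C P Q R X N : PG2 F}

lemma focus_eq (h : FocusData l K D φ t) (hP : P ∈ K) (hPQ : P ≠ Q) (hX : X ∈ l)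
    (hX' : tri P Q X = 0) : φ P Q = X :=
  h.isLine.eq_of_tri (h.notMem P hP) (h.focus_mem P Q) hX
    (tri_trans hPQ (h.tri_focus P Q) hX')

lemma focus_comm (h : FocusData l K D φ t) (hP : P ∈ K) (hPQ : P ≠ Q) : φ P Q = φ Q P :=
  h.focus_eq hP hPQ (h.focus_mem Q P) (by rw [tri_swap, h.tri_focus, neg_zero])

lemma mem_focusSet (h : FocusData l K D φ t) (hP : P ∈ K) (hQ : Q ∈ K) (hPQ : P ≠ Q) :
    φ P Q ∈ D :=
  (h.mem_iff _).mpr ⟨h.focus_mem P Q, P, hP, Q, hQ, hPQ, h.tri_focus P Q⟩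

lemma tri_eq_zero_of_focus_eq (h : FocusData l K D φ t) (hP : P ∈ K)
    (hQR : φ P Q = φ P R) : tri P Q R = 0 := by
  have hne : P ≠ φ P Q := fun e => h.notMem P hP (e ▸ h.focus_mem P Q)
  refine tri_trans hne (by rw [tri_swap_right, h.tri_focus, neg_zero]) ?_
  rw [hQR, tri_swap_right, h.tri_focus, neg_zero]

lemma focus_ne (h : FocusData l K D φ t) (hP : P ∈ K) (hQ : Q ∈ K) (hR : R ∈ K)
    (hPQ : P ≠ Q) (hPR : P ≠ R) (hQR : Q ≠ R) : φ P Q ≠ φ P R :=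
  fun e => h.tri_ne_zero P hP Q hQ R hR hPQ hPR hQR (h.tri_eq_zero_of_focus_eq hP e)

lemma focus_injOn (h : FocusData l K D φ t) (hP : P ∈ K) :
    Set.InjOn (φ P) (K.erase P) := by
  intro Q hQ R hR e
  simp only [Finset.coe_erase, Set.mem_sdiff, Finset.mem_coe, Set.mem_singleton_iff] at hQ hR
  by_contra hne
  exact h.focus_ne hP hQ.1 hR.1 (Ne.symm hQ.2) (Ne.symm hR.2) hne e

lemma focus_ne_tangent (h : FocusData l K D φ t) (hP : P ∈ K) (hQ : Q ∈ K) (hPQ : P ≠ Q) :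
    φ P Q ≠ t P := by
  have := Finset.mem_image_of_mem (φ P) (Finset.mem_erase.mpr ⟨hPQ.symm, hQ⟩)
  rw [h.image_focus P hP] at this
  exact Finset.ne_of_mem_erase this

lemma tangent_mem_line (h : FocusData l K D φ t) (hP : P ∈ K) : t P ∈ l :=
  ((h.mem_iff _).mp (h.tangent_mem P hP)).1

lemma tri_tangent_ne_zero (h : FocusData l K D φ t) (hP : P ∈ K) (hQ : Q ∈ K) (hPQ : P ≠ Q) :
    tri P Q (t P) ≠ 0 :=
  fun e => h.focus_ne_tangent hP hQ hPQ (h.focus_eq hP hPQ (h.tangent_mem_line hP) e)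

lemma cevaRatio_focus (h : FocusData l K D φ t) (hA : A ∈ K) (hC : C ∈ K) (hP : P ∈ K)
    (hAC : A ≠ C) (hAP : A ≠ P) (hCP : C ≠ P) :
    cevaRatio A B C (φ A P) = cevaRatio A B C P := by
  have h1 : tri C A P ≠ 0 := h.tri_ne_zero C hC A hA P hP hAC.symm hCP hAP
  have h2 : tri C A (φ A P) ≠ 0 := fun e =>
    h.focus_ne hA hC hP hAC hAP hCP
      (h.focus_eq hA hAC (h.focus_mem A P) (by rw [tri_swap, e, neg_zero]))
  have := tri_plucker A B C P (φ A P)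
  rw [h.tri_focus] at this
  rw [cevaRatio, cevaRatio, div_eq_div_iff h2 h1]
  linear_combination -this

lemma prod_cevaRatio (h : FocusData l K D φ t) (hA : A ∈ K) (hB : B ∈ K) (hC : C ∈ K)
    (hAB : A ≠ B) (hAC : A ≠ C) (hBC : B ≠ C) :
    cevaRatio A B C (t A) * ∏ P ∈ K \ {A, B, C}, cevaRatio A B C P =
      cevaRatio A B C (φ B C) * ∏ d ∈ D \ {φ B C, φ A B, φ A C}, cevaRatio A B C d := by
  refine prod_eq_of_image_erase (φ := φ A) (h.focus_injOn hA) (h.image_focus A hA)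
    (h.tangent_mem A hA) (h.mem_focusSet hB hC hBC) (by simp [hB, hAB.symm])
    (by simp [hC, hAC.symm]) ?_ ?_ ?_
  · rw [h.focus_comm hA hAB]
    exact h.focus_ne hB hC hA hBC hAB.symm hAC.symm
  · rw [h.focus_comm hA hAC, h.focus_comm hB hBC]
    exact h.focus_ne hC hB hA hBC.symm hAC.symm hAB.symm
  · intro P hP
    simp only [Finset.mem_sdiff, Finset.mem_insert, Finset.mem_singleton, not_or] at hP
    exact h.cevaRatio_focus hA hC hP.1 hAC (Ne.symm hP.2.1) (Ne.symm hP.2.2.2)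

lemma cevaRatio_focus_opposite (h : FocusData l K D φ t) {f : (Fin 3 → F) →ₗ[F] F}
    (hf : l = {P | f P.rep = 0}) (hA : A ∈ K) (hB : B ∈ K) (hC : C ∈ K)
    (hAC : A ≠ C) (hAB : A ≠ B) (hBC : B ≠ C) :
    cevaRatio A B C (φ B C) = - (f B.rep / f C.rep) := by
  have hfC : f C.rep ≠ 0 := fun e => h.notMem C hC (by rw [hf]; exact e)
  have hfX : f (φ B C).rep = 0 := by
    have := h.focus_mem B C
    rw [hf] at this
    exact this
  have h2 : tri C A (φ B C) ≠ 0 := fun e => by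
    apply h.focus_ne hC hA hB hAC.symm hBC.symm hAB
    rw [← h.focus_comm hB hBC]
    exact h.focus_eq hC hAC.symm (h.focus_mem B C) e
  have key := form_barycentric f A B C (φ B C)
  rw [h.tri_focus, hfX] at key
  rw [cevaRatio, ← neg_div, div_eq_div_iff h2 hfC]
  linear_combination -key

lemma cevaRatio_tangent_mul (h : FocusData l K D φ t) (h2 : (2 : F) = 0)
    (hA : A ∈ K) (hB : B ∈ K) (hC : C ∈ K) (hAB : A ≠ B) (hAC : A ≠ C) (hBC : B ≠ C) :
    cevaRatio A B C (t A) * cevaRatio B C A (t B) * cevaRatio C A B (t C) = 1 := by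
  have eA := h.prod_cevaRatio hA hB hC hAB hAC hBC
  have eB := h.prod_cevaRatio hB hC hA hBC hAB.symm hAC.symm
  have eC := h.prod_cevaRatio hC hA hB hAC.symm hBC.symm hAB
  have sB : D \ {φ C A, φ B C, φ B A} = D \ {φ B C, φ A B, φ A C} := by
    rw [h.focus_comm hA hAB, h.focus_comm hA hAC]
    ext; simp; tauto
  have sC : D \ {φ A B, φ C A, φ C B} = D \ {φ B C, φ A B, φ A C} := by
    rw [h.focus_comm hB hBC, h.focus_comm hA hAC]
    ext; simp; tauto
  have kB : K \ {B, C, A} = K \ {A, B, C} := by ext; simp; tauto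
  have kC : K \ {C, A, B} = K \ {A, B, C} := by ext; simp; tauto
  rw [sB, kB] at eB
  rw [sC, kC] at eC
  have pK : (∏ P ∈ K \ {A, B, C}, cevaRatio A B C P) * (∏ P ∈ K \ {A, B, C}, cevaRatio B C A P) *
      ∏ P ∈ K \ {A, B, C}, cevaRatio C A B P = 1 := by
    refine prod_cevaRatio_eq_one fun P hP => ?_
    simp only [Finset.mem_sdiff, Finset.mem_insert, Finset.mem_singleton, not_or] at hP
    obtain ⟨hP, nA, nB, nC⟩ := hP
    exact ⟨h.tri_ne_zero A hA B hB P hP hAB (Ne.symm nA) (Ne.symm nB),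
      h.tri_ne_zero B hB C hC P hP hBC (Ne.symm nB) (Ne.symm nC),
      h.tri_ne_zero C hC A hA P hP hAC.symm (Ne.symm nC) (Ne.symm nA)⟩
  have pD : (∏ d ∈ D \ {φ B C, φ A B, φ A C}, cevaRatio A B C d) *
      (∏ d ∈ D \ {φ B C, φ A B, φ A C}, cevaRatio B C A d) *
      ∏ d ∈ D \ {φ B C, φ A B, φ A C}, cevaRatio C A B d = 1 := by
    refine prod_cevaRatio_eq_one fun d hd => ?_
    simp only [Finset.mem_sdiff, Finset.mem_insert, Finset.mem_singleton, not_or] at hd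
    obtain ⟨hd, nBC, nAB, nAC⟩ := hd
    have hdl := ((h.mem_iff d).mp hd).1
    refine ⟨fun e => nAB (h.focus_eq hA hAB hdl e).symm,
      fun e => nBC (h.focus_eq hB hBC hdl e).symm, fun e => nAC ?_⟩
    rw [h.focus_comm hA hAC]
    exact (h.focus_eq hC hAC.symm hdl e).symm
  obtain ⟨f, -, hf⟩ := h.isLine
  have f0 : ∀ P ∈ K, f P.rep ≠ 0 := fun P hP e => h.notMem P hP (by rw [hf]; exact e)
  have fA := f0 A hA
  have fB := f0 B hB
  have fC := f0 C hC
  rw [h.cevaRatio_focus_opposite hf hA hB hC hAC hAB hBC] at eA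
  rw [h.cevaRatio_focus_opposite hf hB hC hA hAB.symm hBC hAC.symm] at eB
  rw [h.cevaRatio_focus_opposite hf hC hA hB hBC.symm hAC.symm hAB] at eC
  have menelaus : -(f B.rep / f C.rep) * -(f C.rep / f A.rep) * -(f A.rep / f B.rep) = 1 := by
    field_simp
    linear_combination -h2
  have e := congrArg₂ (· * ·) (congrArg₂ (· * ·) eA eB) eC
  simp only at e
  generalize (∏ P ∈ K \ {A, B, C}, cevaRatio A B C P) = k1 at *
  generalize (∏ P ∈ K \ {A, B, C}, cevaRatio B C A P) = k2 at *
  generalize (∏ P ∈ K \ {A, B, C}, cevaRatio C A B P) = k3 at *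
  generalize (∏ d ∈ D \ {φ B C, φ A B, φ A C}, cevaRatio A B C d) = d1 at *
  generalize (∏ d ∈ D \ {φ B C, φ A B, φ A C}, cevaRatio B C A d) = d2 at *
  generalize (∏ d ∈ D \ {φ B C, φ A B, φ A C}, cevaRatio C A B d) = d3 at *
  generalize cevaRatio A B C (t A) = x at *
  generalize cevaRatio B C A (t B) = y at *
  generalize cevaRatio C A B (t C) = z at *
  calc x * y * z = (x * y * z) * (k1 * k2 * k3) := by rw [pK, mul_one]
    _ = (-(f B.rep / f C.rep) * -(f C.rep / f A.rep) * -(f A.rep / f B.rep)) *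
        (d1 * d2 * d3) := by linear_combination e
    _ = 1 := by rw [menelaus, pD, mul_one]

lemma tri_tangent_eq_zero_iff (h : FocusData l K D φ t) (hA : A ∈ K) (hB : B ∈ K) (hC : C ∈ K)
    (hAB : A ≠ B) (hAC : A ≠ C) (hBC : B ≠ C) :
    tri A (t A) N = 0 ↔ tri A B N = cevaRatio A B C (t A) * tri C A N := by
  have h0 : tri C A (t A) ≠ 0 := fun e =>
    h.tri_tangent_ne_zero hA hC hAC (by rw [tri_swap, e, neg_zero])
  have key := tri_plucker A B C (t A) N
  rw [cevaRatio, div_mul_eq_mul_div, eq_div_iff h0]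
  constructor
  · intro e
    rw [e] at key
    linear_combination -key
  · intro e
    have : tri A B C * tri A (t A) N = 0 := by linear_combination key + e
    exact (mul_eq_zero.mp this).resolve_left (h.tri_ne_zero A hA B hB C hC hAB hAC hBC)

/-- The lines joining three points of `K` to the points of `D` they miss are concurrent. -/
lemma tangents_concurrent (h : FocusData l K D φ t) (h2 : (2 : F) = 0)
    (hA : A ∈ K) (hB : B ∈ K) (hC : C ∈ K) (hAB : A ≠ B) (hAC : A ≠ C) (hBC : B ≠ C)
    (hNA : tri A (t A) N = 0) (hNB : tri B (t B) N = 0) : tri C (t C) N = 0 := by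
  have eA := (h.tri_tangent_eq_zero_iff hA hB hC hAB hAC hBC).mp hNA
  have eB := (h.tri_tangent_eq_zero_iff hB hC hA hBC hAB.symm hAC.symm).mp hNB
  have e := h.cevaRatio_tangent_mul h2 hA hB hC hAB hAC hBC
  rw [h.tri_tangent_eq_zero_iff hC hA hB hAC.symm hBC.symm hAB, eB, eA]
  linear_combination -tri C A N * e

lemma exists_nucleus (h : FocusData l K D φ t) (h2 : (2 : F) = 0)
    (hA : A ∈ K) (hB : B ∈ K) (hAB : A ≠ B) :
    ∃ N, ∀ P ∈ K, tri P (t P) N = 0 := by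
  obtain ⟨N, hNA, hNB⟩ := exists_common_zero (triForm A (t A)) (triForm B (t B))
  refine ⟨N, fun P hP => ?_⟩
  by_cases e : A = P
  · subst e; exact hNA
  by_cases e' : B = P
  · subst e'; exact hNB
  exact h.tangents_concurrent h2 hA hB hP hAB e e' hNA hNB

lemma nucleus_notMem (h : FocusData l K D φ t) (hN : ∀ P ∈ K, tri P (t P) N = 0)
    (hA : A ∈ K) (hB : B ∈ K) (hAB : A ≠ B) : N ∉ K := by
  intro hNK
  obtain ⟨P, hP, hPN⟩ : ∃ P ∈ K, P ≠ N := by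
    by_cases e : A = N
    · exact ⟨B, hB, e ▸ hAB.symm⟩
    · exact ⟨A, hA, e⟩
  refine h.tri_tangent_ne_zero hP hNK hPN ?_
  rw [tri_swap_right, hN P hP, neg_zero]

lemma nucleus_notMem_line (h : FocusData l K D φ t) (hN : ∀ P ∈ K, tri P (t P) N = 0)
    (hA : A ∈ K) : N ∉ l := by
  intro hNl
  have ht : ∀ P ∈ K, t P = N := fun P hP =>
    h.isLine.eq_of_tri (h.notMem P hP) (h.tangent_mem_line hP) hNl (hN P hP)
  obtain ⟨-, P, hP, Q, hQ, hPQ, e⟩ := (h.mem_iff N).mp (ht A hA ▸ h.tangent_mem A hA)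
  exact h.tri_tangent_ne_zero hP hQ hPQ (by rwa [ht P hP])

lemma tri_nucleus_ne_zero (h : FocusData l K D φ t) (hN : ∀ P ∈ K, tri P (t P) N = 0)
    (hP : P ∈ K) (hQ : Q ∈ K) (hPQ : P ≠ Q) : tri P Q N ≠ 0 := by
  intro e
  have hPN : P ≠ N := by
    rintro rfl
    exact h.nucleus_notMem hN hP hQ hPQ hP
  refine h.tri_tangent_ne_zero hP hQ hPQ (tri_trans hPN ?_ ?_)
  · rw [tri_swap_right, e, neg_zero]
  · rw [tri_swap_right, hN P hP, neg_zero]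

end FocusData

lemma IsArc.tri_ne_zero [Finite F] {K : Set (PG2 F)} (hK : IsArc K) {P Q R : PG2 F}
    (hP : P ∈ K) (hQ : Q ∈ K) (hR : R ∈ K) (hPQ : P ≠ Q) (hPR : P ≠ R) (hQR : Q ≠ R) :
    tri P Q R ≠ 0 := by
  intro e
  have hsub : ({P, Q, R} : Set (PG2 F)) ⊆ K ∩ {X | tri P Q X = 0} := by
    rintro X (rfl | rfl | rfl)
    · exact ⟨hP, tri_self_left _ _⟩
    · exact ⟨hQ, tri_self_right _ _⟩
    · exact ⟨hR, e⟩
  have h3 : ({P, Q, R} : Set (PG2 F)).ncard = 3 :=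
    Set.ncard_eq_three.mpr ⟨P, Q, R, hPQ, hPR, hQR, rfl⟩
  have := Set.ncard_le_ncard hsub (Set.toFinite _)
  have := hK _ (isLine_tri hPQ)
  omega

lemma mem_focusSet_iff [Finite F] {K l : Set (PG2 F)} {X : PG2 F} :
    X ∈ FocusSet K l ↔ X ∈ l ∧ ∃ P ∈ K, ∃ Q ∈ K, P ≠ Q ∧ tri P Q X = 0 := by
  refine and_congr_right fun _ => ⟨?_, ?_⟩
  · rintro ⟨m, ⟨hm, h2⟩, hX⟩
    obtain ⟨P, hP, Q, hQ, hPQ⟩ := (Set.one_lt_ncard (Set.toFinite _)).mp h2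
    exact ⟨P, hP.1, Q, hQ.1, hPQ, (hm.mem_iff_tri hPQ hP.2 hQ.2 X).mp hX⟩
  · rintro ⟨P, hP, Q, hQ, hPQ, hX⟩
    refine ⟨_, ⟨isLine_tri hPQ, ?_⟩, hX⟩
    exact (Set.one_lt_ncard (Set.toFinite _)).mpr
      ⟨P, ⟨hP, tri_self_left _ _⟩, Q, ⟨hQ, tri_self_right _ _⟩, hPQ⟩

lemma IsLine.exists_notMem {l : Set (PG2 F)} (hl : IsLine l) : ∃ P, P ∉ l := by
  obtain ⟨f, hf, rfl⟩ := hl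
  by_contra! h
  refine hf (LinearMap.ext fun v => ?_)
  by_cases hv : v = 0
  · simp [hv]
  obtain ⟨a, ha⟩ := Projectivization.exists_smul_eq_mk_rep F v hv
  have := h (Projectivization.mk F v hv)
  rw [Set.mem_ofPred_eq, ← ha, Units.smul_def, map_smul, smul_eq_mul] at this
  simpa using this

lemma exists_focusData [Finite F] [DecidableEq (PG2 F)] {K D : Finset (PG2 F)} {l : Set (PG2 F)}
    (hK : IsArc (K : Set (PG2 F))) (hl : IsLine l) (hKl : (K : Set (PG2 F)) ∩ l = ∅)
    (hD : (D : Set (PG2 F)) = FocusSet K l) (hcard : D.card = K.card) :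
    ∃ φ t, FocusData l K D φ t := by
  choose φ hφl hφ using fun P Q => hl.exists_mem_tri P Q
  have notMem : ∀ P ∈ K, P ∉ l := fun P hP hPl => by
    have : P ∈ (K : Set (PG2 F)) ∩ l := ⟨hP, hPl⟩
    simp [hKl] at this
  have memD : ∀ X, X ∈ D ↔ X ∈ l ∧ ∃ P ∈ K, ∃ Q ∈ K, P ≠ Q ∧ tri P Q X = 0 := fun X => by
    rw [← Finset.mem_coe, hD, mem_focusSet_iff]
    rfl
  have ht : ∀ P ∈ K, ∃ t ∈ D, (K.erase P).image (φ P) = D.erase t := by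
    intro P hP
    have hsub : (K.erase P).image (φ P) ⊆ D := by
      intro X hX
      obtain ⟨Q, hQ, rfl⟩ := Finset.mem_image.mp hX
      rw [Finset.mem_erase] at hQ
      exact (memD _).mpr ⟨hφl P Q, P, hP, Q, hQ.2, hQ.1.symm, hφ P Q⟩
    have hinj : Set.InjOn (φ P) (K.erase P) := by
      intro Q hQ R hR e
      rw [Finset.mem_coe, Finset.mem_erase] at hQ hR
      by_contra hne
      refine hK.tri_ne_zero hP hQ.2 hR.2 hQ.1.symm hR.1.symm hne ?_
      refine tri_trans (X := Q) (Y := R) (Q := φ P Q) (fun e' => notMem P hP (e' ▸ hφl P Q)) ?_ ?_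
      · rw [tri_swap_right, hφ, neg_zero]
      · rw [e, tri_swap_right, hφ, neg_zero]
    have hc : ((K.erase P).image (φ P)).card + 1 = D.card := by
      rw [Finset.card_image_of_injOn hinj, Finset.card_erase_add_one hP, hcard]
    have hd : (D \ (K.erase P).image (φ P)).card = 1 := by
      rw [Finset.card_sdiff_of_subset hsub]; omega
    obtain ⟨t, ht⟩ := Finset.card_eq_one.mp hd
    have htD : t ∈ D := (Finset.mem_sdiff.mp (ht ▸ Finset.mem_singleton_self t)).1
    refine ⟨t, htD, ?_⟩
    rw [Finset.erase_eq D, ← ht, Finset.sdiff_sdiff_eq_self hsub]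
  choose! t htD ht using ht
  exact ⟨φ, t, hl, notMem, fun P hP Q hQ R hR => hK.tri_ne_zero hP hQ hR, hφl, hφ, memD, htD, ht⟩

lemma FocusData.isArc_insert [Finite F] [DecidableEq (PG2 F)] {K D : Finset (PG2 F)}
    {l : Set (PG2 F)} {φ : PG2 F → PG2 F → PG2 F} {t : PG2 F → PG2 F} {N : PG2 F}
    (h : FocusData l K D φ t) (hK : IsArc (K : Set (PG2 F)))
    (hN : ∀ P ∈ K, tri P (t P) N = 0) : IsArc (insert N (K : Set (PG2 F))) := by
  intro m hm
  by_cases hNm : N ∈ m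
  · rw [Set.insert_inter_of_mem hNm]
    have h1 : ((K : Set (PG2 F)) ∩ m).ncard ≤ 1 := by
      refine (Set.ncard_le_one (Set.toFinite _)).mpr fun P hP Q hQ => ?_
      by_contra hPQ
      exact h.tri_nucleus_ne_zero hN hP.1 hQ.1 hPQ
        ((hm.mem_iff_tri hPQ hP.2 hQ.2 N).mp hNm)
    have := Set.ncard_insert_le N ((K : Set (PG2 F)) ∩ m)
    omega
  · rw [Set.insert_inter_of_notMem hNm]
    exact hK m hm

lemma FocusData.focusSet_insert [Finite F] [DecidableEq (PG2 F)] {K D : Finset (PG2 F)}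
    {l : Set (PG2 F)} {φ : PG2 F → PG2 F → PG2 F} {t : PG2 F → PG2 F} {N : PG2 F}
    (h : FocusData l K D φ t) (hN : ∀ P ∈ K, tri P (t P) N = 0) :
    FocusSet (insert N (K : Set (PG2 F))) l = D := by
  have hmem : ∀ X ∈ l, ∀ P ∈ K, P ≠ N → tri P N X = 0 → X ∈ D := by
    intro X hX P hP hPN e
    have htX : t P = X := h.isLine.eq_of_tri (h.notMem P hP) (h.tangent_mem_line hP) hX
      (tri_trans hPN (by rw [tri_swap_right, hN P hP, neg_zero]) e)
    exact htX ▸ h.tangent_mem P hP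
  ext X
  rw [mem_focusSet_iff, Finset.mem_coe]
  constructor
  · rintro ⟨hX, P, rfl | hP, Q, rfl | hQ, hPQ, e⟩
    · exact absurd rfl hPQ
    · exact hmem X hX Q hQ hPQ.symm (by rw [tri_swap, e, neg_zero])
    · exact hmem X hX P hP hPQ e
    · exact (h.mem_iff X).mpr ⟨hX, P, hP, Q, hQ, hPQ, e⟩
  · intro hX
    obtain ⟨hX, P, hP, Q, hQ, hPQ, e⟩ := (h.mem_iff X).mp hX
    exact ⟨hX, P, Or.inr hP, Q, Or.inr hQ, hPQ, e⟩

/-- for `q` even, every `k`-arc sharply focused on a line `l` is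
contained in a `(k+1)`-arc hyperfocused on `l`. -/
theorem sharplyFocused_extends_to_hyperfocused {F : Type*} [Field F] [Fintype F]
    (hq : Even (Fintype.card F)) (k : ℕ) (K l : Set (PG2 F))
    (harc : IsArc K) (hcard : K.ncard = k) (hsf : SharplyFocused K l) :
    ∃ K' : Set (PG2 F), K ⊆ K' ∧ IsArc K' ∧ K'.ncard = k + 1 ∧
      Hyperfocused K' l := by
  classical
  obtain ⟨hl, hKl, hfocus⟩ := hsf
  subst hcard
  rcases K.eq_empty_or_nonempty with rfl | ⟨A, hA⟩
  · obtain ⟨N, hN⟩ := hl.exists_notMem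
    refine ⟨{N}, Set.empty_subset _, fun m _ => ?_, by simp, hl, by simpa using hN, ?_⟩
    · refine (Set.ncard_le_ncard Set.inter_subset_left (Set.finite_singleton N)).trans ?_
      simp
    · have : FocusSet {N} l = ∅ := by
        ext X
        simp only [mem_focusSet_iff, Set.mem_singleton_iff, Set.mem_empty_iff_false, iff_false]
        rintro ⟨-, P, rfl, Q, rfl, hPQ, -⟩
        exact hPQ rfl
      simp [this]
  lift K to Finset (PG2 F) using Set.toFinite K
  obtain ⟨D, hD⟩ := (Set.toFinite (FocusSet (K : Set (PG2 F)) l)).exists_finset_coe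
  have hDK : D.card = K.card := by
    rwa [← hD, Set.ncard_coe_finset, Set.ncard_coe_finset] at hfocus
  obtain ⟨φ, t, h⟩ := exists_focusData harc hl hKl hD hDK
  obtain ⟨X, hX⟩ := Finset.card_pos.mp (hDK ▸ Finset.card_pos.mpr ⟨A, hA⟩)
  obtain ⟨-, P, hP, Q, hQ, hPQ, -⟩ := (h.mem_iff X).mp hX
  have h2 : (2 : F) = 0 := by
    have := ringChar.of_eq (FiniteField.even_card_iff_char_two.mpr (Nat.even_iff.mp hq))
    exact CharTwo.two_eq_zero
  obtain ⟨N, hN⟩ := h.exists_nucleus h2 hP hQ hPQ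
  have hcard : (insert N (K : Set (PG2 F))).ncard = (K : Set (PG2 F)).ncard + 1 :=
    Set.ncard_insert_of_notMem (h.nucleus_notMem hN hP hQ hPQ)
  refine ⟨insert N K, Set.subset_insert _ _, h.isArc_insert harc hN, hcard, hl, ?_, ?_⟩
  · rw [Set.insert_inter_of_notMem (h.nucleus_notMem_line hN hP), hKl]
  · rw [h.focusSet_insert hN, hcard, Set.ncard_coe_finset, Set.ncard_coe_finset, hDK,
      Nat.add_sub_cancel]
end
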